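/- Suppose S is smooth and let 1 ≤ i ≤ n−p. For an integer j ≥ i set v_i(j) := (j−i+1)·j. Then there exists a nonempty Zariski open subset U_i of full-rank matrices of ℂ^{(n−p−i+1)×n} such that for every a ∈ U_i and every index i ≤ j ≤ n−p, the constructible set Σ^{(j)}(π_a) is empty or a smooth subvariety of S of codimension v_i(j). -/

import Mathlib

open MvPolynomial

noncomputable section

/-- The Zariski closure of a subset of the affine space `σ → ℂ`. -/
def zcl {σ : Type} (T : Set (σ → ℂ)) : Set (σ → ℂ) :=
  MvPolynomial.zeroLocus ℂ (MvPolynomial.vanishingIdeal ℂ T)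

/-- Zariski open subsets of the affine space `σ → ℂ`. -/
def ZOpen {σ : Type} (U : Set (σ → ℂ)) : Prop :=
  ∃ I : Ideal (MvPolynomial σ ℂ), U = {x | ∃ f ∈ I, MvPolynomial.eval x f ≠ 0}

/-- Zariski open subsets of the space of `m × n` complex matrices. -/
def ZOpenMat {m n : ℕ} (U : Set (Matrix (Fin m) (Fin n) ℂ)) : Prop :=
  ∃ I : Ideal (MvPolynomial (Fin m × Fin n) ℂ),
    U = {a | ∃ f ∈ I, MvPolynomial.eval (fun q => a q.1 q.2) f ≠ 0}

/-- `T` is of pure dimension `d`: every irreducible component of (the Zariski closure of) `T`,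
i.e. every minimal prime over its vanishing ideal, has coordinate ring of Krull dimension `d`. -/
def IsPureDim {σ : Type} (T : Set (σ → ℂ)) (d : ℕ) : Prop :=
  ∀ P ∈ (MvPolynomial.vanishingIdeal ℂ T).minimalPrimes,
    ringKrullDim (MvPolynomial σ ℂ ⧸ P) = (d : WithBot (WithTop ℕ))

/-- The Zariski tangent space at a point `x` of (the Zariski closure of) a subset `T`
of affine space: the common kernel of the differentials at `x` of all polynomials
vanishing on `T`. -/
def tangentAt {σ : Type} [Fintype σ] [DecidableEq σ] (T : Set (σ → ℂ)) (x : σ → ℂ) :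
    Submodule ℂ (σ → ℂ) :=
  ⨅ (f : MvPolynomial σ ℂ) (_ : f ∈ MvPolynomial.vanishingIdeal ℂ T),
    LinearMap.ker
      (∑ l, MvPolynomial.eval x (MvPolynomial.pderiv l f) •
        (LinearMap.proj l : (σ → ℂ) →ₗ[ℂ] ℂ))

/-- `rs` is a regular sequence in the commutative ring `R`. -/
def IsRegSeq {R : Type*} [CommRing R] (rs : List R) : Prop :=
  Ideal.span {x | x ∈ rs} ≠ ⊤ ∧
  ∀ j, j < rs.length → ∀ b : R,
    rs.getD j 0 * b ∈ Ideal.span {x | x ∈ rs.take j} →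
    b ∈ Ideal.span {x | x ∈ rs.take j}

/-- The common zero set in `ℂⁿ` of polynomials `F₁, …, F_p ∈ ℚ[X₁, …, Xₙ]`. -/
def zeroSetC {n p : ℕ} (F : Fin p → MvPolynomial (Fin n) ℚ) : Set (Fin n → ℂ) :=
  {x | ∀ k, MvPolynomial.aeval x (F k) = 0}

/-- The Jacobian matrix `[∂F_k/∂X_l]` evaluated at `x ∈ ℂⁿ`. -/
def jacC {n p : ℕ} (F : Fin p → MvPolynomial (Fin n) ℚ) (x : Fin n → ℂ) :
    Matrix (Fin p) (Fin n) ℂ :=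
  Matrix.of fun k l => MvPolynomial.aeval x (MvPolynomial.pderiv l (F k))

/-- The set of regular points of `S = {F₁ = 0, …, F_p = 0}`: points of `S` where the
Jacobian has maximal rank `p`. -/
def SregC {n p : ℕ} (F : Fin p → MvPolynomial (Fin n) ℚ) : Set (Fin n → ℂ) :=
  {x | x ∈ zeroSetC F ∧ (jacC F x).rank = p}

/-- The classic polar variety: the Zariski closure of the locus of regular points of `S`
where the matrix obtained by appending the rows of `a` to the Jacobian has rank at
most `r` (i.e. where all `(r+1)`-minors vanish). -/
def Wclassic {n p m : ℕ} (F : Fin p → MvPolynomial (Fin n) ℚ)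
    (a : Matrix (Fin m) (Fin n) ℂ) (r : ℕ) : Set (Fin n → ℂ) :=
  zcl {x | x ∈ SregC F ∧ (Matrix.fromRows (jacC F x) a).rank ≤ r}

/-- The dual polar variety: as `Wclassic`, with appended rows `(a_{k,1} - X₁, …, a_{k,n} - Xₙ)`. -/
def Wdual {n p m : ℕ} (F : Fin p → MvPolynomial (Fin n) ℚ)
    (a : Matrix (Fin m) (Fin n) ℂ) (r : ℕ) : Set (Fin n → ℂ) :=
  zcl {x | x ∈ SregC F ∧
    (Matrix.fromRows (jacC F x) (Matrix.of fun k l => a k l - x l)).rank ≤ r}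

/-- `F₁, …, F_p` generate the full vanishing ideal of their zero set (over `ℂ`);
this encodes that `(F₁, …, F_p)` is reduced (radical) and the ideal of definition of `S`. -/
def idealOfDef {n p : ℕ} (F : Fin p → MvPolynomial (Fin n) ℚ) : Prop :=
  MvPolynomial.vanishingIdeal ℂ (zeroSetC F) =
    Ideal.span (Set.range fun k => MvPolynomial.map (algebraMap ℚ ℂ) (F k))

/-- The submatrix of the first `m` rows of a matrix. -/
def firstRows {N n' m : ℕ} (a : Matrix (Fin N) (Fin n') ℂ) (h : m ≤ N) :
    Matrix (Fin m) (Fin n') ℂ :=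
  Matrix.of fun k l => a (Fin.castLE h k) l

/-- The matrix obtained by deleting row `h`. -/
def rowErase {m n' : ℕ} (a : Matrix (Fin (m + 1)) (Fin n') ℂ) (h : Fin (m + 1)) :
    Matrix (Fin m) (Fin n') ℂ :=
  Matrix.of fun k l => a (h.succAbove k) l

/-- The real trace `S_ℝ := S ∩ ℝⁿ`, as a subset of Euclidean space. -/
def SR {n p : ℕ} (F : Fin p → MvPolynomial (Fin n) ℚ) : Set (EuclideanSpace ℝ (Fin n)) :=
  {x | (fun j => (x j : ℂ)) ∈ zeroSetC F}

/-- `C` is a connected component of `T`. -/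
def IsConnCompOf {α : Type*} [TopologicalSpace α] (C T : Set α) : Prop :=
  C.Nonempty ∧ C ⊆ T ∧ IsPreconnected C ∧
    ∀ D, C ⊆ D → D ⊆ T → IsPreconnected D → D = C

end

/-- The Thom–Boardman stratum \`Σ^{(j)}(π_a)\`: the set of regular points of \`S\` at which
the kernel of the differential of \`π_a\` (the linear map induced by \`a\`) restricted to the
Zariski tangent space of \`S\` has dimension \`j\`. -/
noncomputable def SigmaStr {n p m : ℕ} (F : Fin p → MvPolynomial (Fin n) ℚ)
    (a : Matrix (Fin m) (Fin n) ℂ) (j : ℕ) : Set (Fin n → ℂ) :=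
  {x | x ∈ SregC F ∧
    Module.finrank ℂ
      ↥(tangentAt (zeroSetC F) x ⊓ LinearMap.ker (Matrix.mulVecLin a)) = j}

section Derivations

open TensorProduct

theorem Derivation.exists_extend_of_formallyEtale {R A B M : Type*} [CommRing R] [CommRing A]
    [CommRing B] [Algebra R A] [Algebra R B] [Algebra A B] [IsScalarTower R A B]
    [Algebra.FormallyEtale A B] [AddCommGroup M] [Module R M] [Module A M] [Module B M]
    [IsScalarTower R A M] [IsScalarTower R B M] [IsScalarTower A B M]
    (d : Derivation R A M) : ∃ d' : Derivation R B M, ∀ a, d' (algebraMap A B a) = d a := by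
  let φ : B ⊗[A] Ω[A⁄R] →ₗ[B] M := LinearMap.liftBaseChange B d.liftKaehlerDifferential
  let e := KaehlerDifferential.tensorKaehlerEquivOfFormallyEtale R A B
  refine ⟨(φ ∘ₗ e.symm.toLinearMap).compDer (KaehlerDifferential.D R B), fun a => ?_⟩
  have h := KaehlerDifferential.tensorKaehlerEquivOfFormallyEtale_symm_D_algebraMap R A B a
  change φ (e.symm (KaehlerDifferential.D R B (algebraMap A B a))) = d a
  rw [h, LinearMap.liftBaseChange_tmul, one_smul, Derivation.liftKaehlerDifferential_comp_D]

theorem Derivation.eq_zero_of_formallyUnramified {R A B M : Type*} [CommRing R] [CommRing A]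
    [CommRing B] [Algebra R A] [Algebra R B] [Algebra A B] [IsScalarTower R A B]
    [Algebra.FormallyUnramified A B] [AddCommGroup M] [Module R M] [Module A M] [Module B M]
    [IsScalarTower R A M] [IsScalarTower R B M] [IsScalarTower A B M]
    (d : Derivation R B M) (h : ∀ a, d (algebraMap A B a) = 0) : d = 0 := by
  have hs : ∀ (a : A) (b : B), d (a • b) = a • d b := fun a b => by
    rw [Algebra.smul_def, d.leibniz, h, smul_zero, add_zero, algebraMap_smul]
  let l : B →ₗ[A] M := { toFun := d, map_add' := d.map_add, map_smul' := hs }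
  let d' : Derivation A B M := Derivation.mk' l fun a b => d.leibniz a b
  have h' : d'.liftKaehlerDifferential = 0 := by
    refine LinearMap.ext fun x => ?_
    rw [Subsingleton.elim x 0, map_zero, map_zero]
  ext b
  have := d'.liftKaehlerDifferential_comp_D b
  rw [h'] at this
  exact this.symm

theorem MvPolynomial.derivation_aeval {R B M σ : Type*} [CommRing R] [CommRing B] [Algebra R B]
    [AddCommGroup M] [Module R M] [Module B M] [IsScalarTower R B M] [Fintype σ]
    (d : Derivation R B M) (z : σ → B) (f : MvPolynomial σ R) :
    d (aeval z f) = ∑ i, aeval z (pderiv i f) • d (z i) := by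
  classical
  induction f using MvPolynomial.induction_on with
  | C a => simp
  | add p q hp hq => simp [hp, hq, add_smul, Finset.sum_add_distrib]
  | mul_X p i hp =>
    simp only [map_mul, aeval_X, d.leibniz, hp, pderiv_mul, map_add, add_smul,
      Finset.sum_add_distrib, pderiv_X, Finset.smul_sum]
    rw [add_comm]
    congr 1
    · exact Finset.sum_congr rfl fun j _ => by rw [smul_smul, mul_comm]
    · rw [Finset.sum_eq_single i]
      · simp
      · intro j _ hj
        simp [Pi.single_eq_of_ne hj.symm]
      · simp

theorem IsTranscendenceBasis.formallyEtale {K L s : Type*} [Field K] [CharZero K] [Field L]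
    [Algebra K L] [Algebra (MvPolynomial s K) L] [IsScalarTower K (MvPolynomial s K) L]
    {v : s → L} (hv : IsTranscendenceBasis K v)
    (hX : ∀ i, algebraMap (MvPolynomial s K) L (X i) = v i) :
    Algebra.FormallyEtale (MvPolynomial s K) L := by
  have halg : (algebraMap (MvPolynomial s K) L) = (aeval v : MvPolynomial s K →ₐ[K] L) := by
    refine MvPolynomial.ringHom_ext (fun c => ?_) fun i => ?_
    · rw [← MvPolynomial.algebraMap_eq, ← IsScalarTower.algebraMap_apply]
      exact ((aeval v).commutes c).symm
    · simp [hX]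
  have : FaithfulSMul (MvPolynomial s K) L := by
    rw [faithfulSMul_iff_algebraMap_injective, halg]
    exact hv.1
  let E := FractionRing (MvPolynomial s K)
  let : Algebra E L := FractionRing.liftAlgebra _ _
  have : IsScalarTower (MvPolynomial s K) E L := FractionRing.isScalarTower_liftAlgebra _ _
  have : CharZero E := charZero_of_injective_algebraMap (algebraMap K E).injective
  have : Algebra.IsAlgebraic (MvPolynomial s K) L := by
    have := hv.isAlgebraic
    refine ⟨fun x => ?_⟩
    have hx := this.isAlgebraic x
    obtain ⟨p, hp, hpx⟩ := hx
    refine ⟨p.map (hv.1.aevalEquiv.symm : _ →+* _), ?_, ?_⟩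
    · rwa [Ne, Polynomial.map_eq_zero_iff]
      exact hv.1.aevalEquiv.symm.injective
    · rw [Polynomial.aeval_def, Polynomial.eval₂_map]
      rw [Polynomial.aeval_def] at hpx
      convert hpx
      ext y
      obtain ⟨y, rfl⟩ := hv.1.aevalEquiv.surjective y
      simp [halg]
  have : Algebra.IsAlgebraic E L :=
    (IsFractionRing.comap_isAlgebraic_iff (A := MvPolynomial s K)).1 this
  have : Algebra.FormallyEtale E L := Algebra.FormallyEtale.of_isSeparable E L
  have : Algebra.FormallyEtale (MvPolynomial s K) E :=
    .of_isLocalization (nonZeroDivisors _)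
  exact .comp _ E _

theorem AlgebraicIndependent.exists_derivation {K L s : Type*} [Field K] [CharZero K] [Field L]
    [Algebra K L] {v : s → L} (hv : AlgebraicIndependent K v) (w : s → L) :
    ∃ d : Derivation K L L, ∀ i, d (v i) = w i := by
  classical
  obtain ⟨t, ht, htb⟩ := exists_isTranscendenceBasis_superset hv.coe_range
  let : Algebra (MvPolynomial t K) L := (aeval ((↑) : t → L)).toAlgebra
  have : IsScalarTower K (MvPolynomial t K) L := .of_algebraMap_eq fun x => by
    simp [RingHom.algebraMap_toAlgebra]
  have hX : ∀ i, algebraMap (MvPolynomial t K) L (X i) = i := fun i => by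
    simp [RingHom.algebraMap_toAlgebra]
  have := htb.formallyEtale hX
  have hinj : Function.Injective v := hv.injective
  obtain ⟨d, hd⟩ := Derivation.exists_extend_of_formallyEtale (B := L)
    (MvPolynomial.mkDerivation K (fun x : t => if h : ∃ i, v i = x then w h.choose else 0) :
      Derivation K (MvPolynomial t K) L)
  refine ⟨d, fun i => ?_⟩
  have h1 := hd (X ⟨v i, ht ⟨i, rfl⟩⟩)
  rw [hX, mkDerivation_X] at h1
  have h2 : ∃ j, v j = v i := ⟨i, rfl⟩
  simp only [h2, dif_pos] at h1
  rw [h1, hinj h2.choose_spec]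

theorem IsTranscendenceBasis.derivation_eq_zero {K L s : Type*} [Field K] [CharZero K] [Field L]
    [Algebra K L] {v : s → L} (hv : IsTranscendenceBasis K v) (d : Derivation K L L)
    (h : ∀ i, d (v i) = 0) : d = 0 := by
  let : Algebra (MvPolynomial s K) L := (aeval v).toAlgebra
  have : IsScalarTower K (MvPolynomial s K) L := .of_algebraMap_eq fun x => by
    simp [RingHom.algebraMap_toAlgebra]
  have hX : ∀ i, algebraMap (MvPolynomial s K) L (X i) = v i := fun i => by
    simp [RingHom.algebraMap_toAlgebra]
  have := hv.formallyEtale hX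
  refine Derivation.eq_zero_of_formallyUnramified (A := MvPolynomial s K) d fun a => ?_
  have h0 : d.compAlgebraMap (MvPolynomial s K) = 0 := by
    refine MvPolynomial.derivation_ext fun i => ?_
    simp [hX, h]
  exact DFunLike.congr_fun h0 a

/-- In characteristic zero, the dimension of the space of derivations of a field extension is its
transcendence degree. -/
theorem IsTranscendenceBasis.finrank_derivation {K L s : Type*} [Field K] [CharZero K] [Field L]
    [Algebra K L] [Fintype s] {v : s → L} (hv : IsTranscendenceBasis K v) :
    Module.finrank L (Derivation K L L) = Fintype.card s := by
  let φ : Derivation K L L →ₗ[L] (s → L) :=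
    { toFun := fun d i => d (v i), map_add' := fun _ _ => rfl, map_smul' := fun _ _ => rfl }
  have hφ : Function.Bijective φ := by
    refine ⟨(injective_iff_map_eq_zero φ).2 fun d hd =>
      hv.derivation_eq_zero d fun i => congrFun hd i, fun w => ?_⟩
    obtain ⟨d, hd⟩ := hv.1.exists_derivation w
    exact ⟨d, funext hd⟩
  rw [(LinearEquiv.ofBijective φ hφ).finrank_eq, Module.finrank_fintype_fun_eq_card]

end Derivations

section KrullDimension

theorem ringKrullDim_eq_of_isIntegral {R S : Type*} [CommRing R] [CommRing S] [Algebra R S]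
    [Algebra.IsIntegral R S] [FaithfulSMul R S] : ringKrullDim S = ringKrullDim R := by
  refine le_antisymm (Order.krullDim_le_of_strictMono
    (PrimeSpectrum.comap (algebraMap R S)) fun P Q h => Ideal.IsIntegral.comap_lt_comap h)
    (iSup_le fun l => ?_)
  obtain ⟨P, hP, hP'⟩ : Nonempty (Ideal.primesOver l.head.asIdeal S) := inferInstance
  have := hP
  have := hP'
  obtain ⟨L, hL, -⟩ := Ideal.exists_ltSeries_of_hasGoingUp l P
  rw [← hL]
  exact le_sSup ⟨L, rfl⟩

/-- The Krull dimension of an affine domain in characteristic zero is the dimension of the space of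
derivations of its fraction field. -/
theorem ringKrullDim_eq_finrank_derivation {k A K : Type*} [Field k] [CharZero k] [CommRing A]
    [IsDomain A] [Algebra k A] [Algebra.FiniteType k A] [Field K] [Algebra A K]
    [IsFractionRing A K] [Algebra k K] [IsScalarTower k A K] :
    ringKrullDim A = (Module.finrank K (Derivation k K K) : WithBot ℕ∞) := by
  obtain ⟨s, g, hg, hgi⟩ := exists_integral_inj_algHom_of_fg k A
  let : Algebra (MvPolynomial (Fin s) k) A := g.toRingHom.toAlgebra
  have : IsScalarTower k (MvPolynomial (Fin s) k) A := .of_algebraMap_eq fun x => by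
    simp [RingHom.algebraMap_toAlgebra]
  have : Algebra.IsIntegral (MvPolynomial (Fin s) k) A := ⟨hgi⟩
  have : FaithfulSMul (MvPolynomial (Fin s) k) A := (faithfulSMul_iff_algebraMap_injective _ _).2 hg
  have : FaithfulSMul A K :=
    (faithfulSMul_iff_algebraMap_injective _ _).2 (IsFractionRing.injective A K)
  have : Algebra.IsAlgebraic A K := IsLocalization.isAlgebraic K (nonZeroDivisors A)
  have hX : IsTranscendenceBasis k (X : Fin s → MvPolynomial (Fin s) k) :=
    .mvPolynomial _ _
  have hK := (hX.algebraMap_comp (A := A)).algebraMap_comp (A := K)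
  rw [hK.finrank_derivation, ringKrullDim_eq_of_isIntegral (R := MvPolynomial (Fin s) k),
    MvPolynomial.ringKrullDim_of_isNoetherianRing, ringKrullDim_eq_zero_of_field]
  simp

end KrullDimension

section Gradient

open Filter Topology

/-- The gradient of a polynomial at a point with coordinates in an algebra. -/
noncomputable def MvPolynomial.grad {R B σ : Type*} [CommRing R] [CommRing B] [Algebra R B]
    (z : σ → B) (f : MvPolynomial σ R) : σ → B :=
  fun l => aeval z (pderiv l f)

theorem MvPolynomial.grad_add {R B σ : Type*} [CommRing R] [CommRing B] [Algebra R B]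
    (z : σ → B) (f g : MvPolynomial σ R) : grad z (f + g) = grad z f + grad z g := by
  ext l
  simp [grad]

theorem MvPolynomial.grad_mul {R B σ : Type*} [CommRing R] [CommRing B] [Algebra R B]
    (z : σ → B) (f g : MvPolynomial σ R) :
    grad z (f * g) = aeval z f • grad z g + aeval z g • grad z f := by
  ext l
  simp [grad]

theorem MvPolynomial.grad_X {R B σ : Type*} [CommRing R] [CommRing B] [Algebra R B]
    [DecidableEq σ] (z : σ → B) (i : σ) :
    grad z (X i : MvPolynomial σ R) = Pi.single i 1 := by
  ext l
  rcases eq_or_ne l i with rfl | h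
  · simp [grad]
  · simp [grad, pderiv_X, Pi.single_eq_of_ne h, Pi.single_eq_of_ne h.symm]

theorem MvPolynomial.hasStrictFDerivAt_aeval {σ : Type*} [Fintype σ] (x : σ → ℂ)
    (f : MvPolynomial σ ℂ) :
    HasStrictFDerivAt (fun y : σ → ℂ => aeval y f)
      (∑ l, grad x f l • (ContinuousLinearMap.proj l : (σ → ℂ) →L[ℂ] ℂ)) x := by
  classical
  induction f using MvPolynomial.induction_on with
  | C a =>
    simp only [aeval_C, Algebra.algebraMap_self_apply]
    refine (hasStrictFDerivAt_const a x).congr_fderiv ?_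
    ext v
    simp [grad]
  | add p q hp hq =>
    simp only [map_add]
    refine (hp.add hq).congr_fderiv ?_
    ext v
    simp [grad_add, add_mul, Finset.sum_add_distrib]
  | mul_X p i hp =>
    have hX : HasStrictFDerivAt (fun y : σ → ℂ => y i)
        (ContinuousLinearMap.proj i : (σ → ℂ) →L[ℂ] ℂ) x :=
      (ContinuousLinearMap.proj (R := ℂ) (φ := fun _ : σ => ℂ) i).hasStrictFDerivAt
    simp only [map_mul, aeval_X]
    refine (hp.mul hX).congr_fderiv ?_
    ext v
    simp only [grad_mul, grad_X, Pi.add_apply, Pi.smul_apply, aeval_X, smul_eq_mul, add_mul,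
      Finset.sum_add_distrib, _root_.add_apply, _root_.smul_apply,
      _root_.sum_apply, ContinuousLinearMap.proj_apply, Finset.mul_sum, mul_assoc]
    simp [Pi.single_apply]

theorem Matrix.mulVec_surjective_of_linearIndependent_row {K m n : Type*} [Field K] [Fintype m]
    [Fintype n] {M : Matrix m n K} (h : LinearIndependent K M.row) :
    Function.Surjective M.mulVec := by
  have h1 : Module.finrank K (LinearMap.range M.mulVecLin) = Module.finrank K (m → K) := by
    rw [Module.finrank_fintype_fun_eq_card]
    exact h.rank_matrix
  have h2 := Submodule.eq_top_of_finrank_eq h1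
  exact LinearMap.range_eq_top.1 h2

theorem MvPolynomial.map_nhds_eq_of_linearIndependent_grad {σ κ : Type*} [Fintype σ] [Fintype κ]
    {G : κ → MvPolynomial σ ℂ} {x : σ → ℂ} (h : LinearIndependent ℂ fun k => grad x (G k)) :
    Filter.map (fun y : σ → ℂ => fun k => aeval y (G k)) (𝓝 x) = 𝓝 (fun k => aeval x (G k)) := by
  have h1 : HasStrictFDerivAt (fun y : σ → ℂ => fun k => aeval y (G k)) _ x :=
    hasStrictFDerivAt_pi.2 fun k => hasStrictFDerivAt_aeval x (G k)
  refine h1.map_nhds_eq_of_surj (LinearMap.range_eq_top.2 fun w => ?_)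
  obtain ⟨v, rfl⟩ := Matrix.mulVec_surjective_of_linearIndependent_row
    (M := Matrix.of fun k l => grad x (G k) l) h w
  exact ⟨v, by ext k; simp [Matrix.mulVec, dotProduct]⟩

theorem MvPolynomial.grad_mem_span_of_mem_vanishingIdeal {σ ι : Type*} [Fintype σ] [Fintype ι]
    {H : ι → MvPolynomial σ ℂ} {D : MvPolynomial σ ℂ} {T : Set (σ → ℂ)} {x : σ → ℂ}
    (hT : ∀ y, (∀ k, aeval y (H k) = 0) → aeval y D ≠ 0 → y ∈ T)
    (hx : ∀ k, aeval x (H k) = 0) (hxD : aeval x D ≠ 0)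
    (h : LinearIndependent ℂ fun k => grad x (H k)) {f : MvPolynomial σ ℂ}
    (hf : f ∈ vanishingIdeal ℂ T) :
    grad x f ∈ Submodule.span ℂ (Set.range fun k => grad x (H k)) := by
  classical
  by_contra hfx
  let G : Option ι → MvPolynomial σ ℂ := fun o => o.elim f H
  have hG : LinearIndependent ℂ fun k => grad x (G k) := by
    have h1 := h.option hfx
    have h2 : (fun k => grad x (G k)) = fun o : Option ι => o.casesOn' (grad x f) fun k =>
        grad x (H k) := by
      ext k : 1
      cases k <;> rfl
    rw [h2]
    exact h1
  have hmap := map_nhds_eq_of_linearIndependent_grad hG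
  have hG0 : (fun k => aeval x (G k)) = 0 := by
    ext k
    cases k with
    | none => exact hf x (hT x hx hxD)
    | some k => exact hx k
  have hD : ∀ᶠ y in 𝓝 x, aeval y D ≠ 0 :=
    (hasStrictFDerivAt_aeval x D).continuousAt.eventually_ne hxD
  have hD' := Filter.image_mem_map (m := fun y : σ → ℂ => fun k => aeval y (G k)) hD
  rw [hmap, hG0] at hD'
  have ht : Tendsto (fun ε : ℂ => (Pi.single none ε : Option ι → ℂ)) (𝓝[≠] 0) (𝓝 0) := by
    have : Continuous fun ε : ℂ => (Pi.single none ε : Option ι → ℂ) :=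
      continuous_single (A := fun _ : Option ι => ℂ) none
    simpa using (this.tendsto 0).mono_left nhdsWithin_le_nhds
  obtain ⟨ε, ⟨y, hy, hyε⟩, hε⟩ := ((ht.eventually hD').and self_mem_nhdsWithin).exists
  refine hε ?_
  have h1 : aeval y f = ε := by simpa [G] using congrFun hyε none
  rw [← h1]
  refine hf y (hT y (fun k => ?_) hy)
  simpa [G] using congrFun hyε (some k)

end Gradient

section Tangent

theorem mem_tangentAt {σ : Type} [Fintype σ] [DecidableEq σ] {T : Set (σ → ℂ)} {x v : σ → ℂ} :
    v ∈ tangentAt T x ↔ ∀ f ∈ vanishingIdeal ℂ T, grad x f ⬝ᵥ v = 0 := by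
  simp [tangentAt, Submodule.mem_iInf, grad, dotProduct]

theorem tangentAt_eq_ker {σ ι : Type} [Fintype σ] [DecidableEq σ] [Fintype ι]
    {H : ι → MvPolynomial σ ℂ} {D : MvPolynomial σ ℂ} {T : Set (σ → ℂ)} {x : σ → ℂ}
    (hT : ∀ y, aeval y D ≠ 0 → (y ∈ T ↔ ∀ k, aeval y (H k) = 0))
    (hx : x ∈ T) (hxD : aeval x D ≠ 0) (h : LinearIndependent ℂ fun k => grad x (H k)) :
    tangentAt T x = LinearMap.ker (Matrix.of fun k => grad x (H k)).mulVecLin := by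
  ext v
  rw [mem_tangentAt, LinearMap.mem_ker, Matrix.mulVecLin_apply]
  constructor
  · intro hv
    ext k
    have h1 : D * H k ∈ vanishingIdeal ℂ T := fun y hy => by
      by_cases hyD : aeval y D = 0
      · rw [map_mul, hyD, zero_mul]
      · rw [map_mul, (hT y hyD).1 hy, mul_zero]
    have h2 := hv _ h1
    rw [grad_mul, (hT x hxD).1 hx, zero_smul, add_zero, smul_dotProduct, smul_eq_mul,
      mul_eq_zero] at h2
    exact h2.resolve_left hxD
  · intro hv f hf
    have hs := grad_mem_span_of_mem_vanishingIdeal (fun y hy hyD => (hT y hyD).2 hy)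
      ((hT x hxD).1 hx) hxD h hf
    generalize grad x f = g at hs
    induction hs using Submodule.span_induction with
    | mem w hw =>
      obtain ⟨k, rfl⟩ := hw
      exact congrFun hv k
    | zero => exact zero_dotProduct v
    | add w w' _ _ hw hw' => rw [add_dotProduct, hw, hw', add_zero]
    | smul c w _ hw => rw [smul_dotProduct, hw, smul_zero]

theorem finrank_tangentAt {σ ι : Type} [Fintype σ] [DecidableEq σ] [Fintype ι]
    {H : ι → MvPolynomial σ ℂ} {D : MvPolynomial σ ℂ} {T : Set (σ → ℂ)} {x : σ → ℂ}
    (hT : ∀ y, aeval y D ≠ 0 → (y ∈ T ↔ ∀ k, aeval y (H k) = 0))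
    (hx : x ∈ T) (hxD : aeval x D ≠ 0) (h : LinearIndependent ℂ fun k => grad x (H k)) :
    Module.finrank ℂ (tangentAt T x) + Fintype.card ι = Fintype.card σ := by
  rw [tangentAt_eq_ker hT hx hxD h]
  have h1 := LinearMap.finrank_range_add_finrank_ker (Matrix.of fun k => grad x (H k)).mulVecLin
  have h2 : (Matrix.of fun k => grad x (H k)).rank = Fintype.card ι :=
    LinearIndependent.rank_matrix h
  rw [Module.finrank_fintype_fun_eq_card] at h1
  rw [← h1, ← h2, add_comm]
  rfl

end Tangent

section Dimension

theorem Ideal.IsRadical.exists_notMem_mul_mem {R : Type*} [CommRing R] {I P : Ideal R}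
    (hI : I.IsRadical) (hP : P ∈ I.minimalPrimes) {f : R} (hf : f ∈ P) : ∃ s ∉ P, s * f ∈ I := by
  have := hP.isPrime
  by_contra! h
  obtain ⟨Q, hQ, hIQ, hQd⟩ := Ideal.exists_le_prime_disjoint I (P.primeCompl ⊔ Submonoid.powers f) <|
    Set.disjoint_left.2 fun x hxI hx => by
      obtain ⟨s, hs, _, ⟨n, rfl⟩, rfl⟩ := Submonoid.mem_sup.1 hx
      refine h s hs (hI ⟨n + 1, ?_⟩)
      have : (s * f) ^ (n + 1) = (s ^ n * f) * (s * f ^ n) := by ring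
      rw [this]
      exact I.mul_mem_left _ hxI
  have hQP : Q ≤ P := fun x hx => by
    by_contra hxP
    exact Set.disjoint_left.1 hQd hx (Submonoid.mem_sup_left hxP)
  exact Set.disjoint_left.1 hQd (hP.2 ⟨hQ, hIQ⟩ hQP hf)
    (Submonoid.mem_sup_right (Submonoid.mem_powers f))

theorem MvPolynomial.isRadical_vanishingIdeal {σ : Type*} (T : Set (σ → ℂ)) :
    (vanishingIdeal ℂ T).IsRadical := by
  rintro f ⟨n, hn⟩ x hx
  have := hn x hx
  rw [map_pow] at this
  exact eq_zero_of_pow_eq_zero this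

theorem MvPolynomial.aeval_algebraMap_X {R σ B : Type*} [CommRing R] [CommRing B] [Algebra R B]
    [Algebra (MvPolynomial σ R) B] [IsScalarTower R (MvPolynomial σ R) B] (f : MvPolynomial σ R) :
    aeval (fun l => algebraMap (MvPolynomial σ R) B (X l)) f = algebraMap _ B f := by
  have := aeval_algebraMap_apply (R := R) B (X : σ → MvPolynomial σ R) f
  rwa [aeval_X_left_apply] at this

variable {σ : Type} {P : Ideal (MvPolynomial σ ℂ)} [hPp : P.IsPrime]
  {K : Type} [Field K] [Algebra ℂ K] [Algebra (MvPolynomial σ ℂ) K]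
  [Algebra (MvPolynomial σ ℂ ⧸ P) K] [IsScalarTower ℂ (MvPolynomial σ ℂ) K]
  [IsScalarTower (MvPolynomial σ ℂ) (MvPolynomial σ ℂ ⧸ P) K]
  [IsFractionRing (MvPolynomial σ ℂ ⧸ P) K]

theorem algebraMap_eq_zero_iff_mem_of_isFractionRing_quotient {R K : Type*} [CommRing R]
    (P : Ideal R) [CommRing K] [Algebra R K] [Algebra (R ⧸ P) K] [IsScalarTower R (R ⧸ P) K]
    [IsFractionRing (R ⧸ P) K] {f : R} : algebraMap R K f = 0 ↔ f ∈ P := by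
  rw [IsScalarTower.algebraMap_apply R (R ⧸ P) K, ← map_zero (algebraMap (R ⧸ P) K),
    (IsFractionRing.injective (R ⧸ P) K).eq_iff, Ideal.Quotient.algebraMap_eq,
    Ideal.Quotient.eq_zero_iff_mem]

theorem exists_common_denominator_of_isFractionRing_quotient {R K : Type*} [CommRing R]
    (P : Ideal R) [P.IsPrime] [CommRing K] [Algebra R K] [Algebra (R ⧸ P) K]
    [IsScalarTower R (R ⧸ P) K] [IsFractionRing (R ⧸ P) K] {α : Type*} [Finite α] (c : α → K) :
    ∃ g ∉ P, ∃ p : α → R, ∀ a, algebraMap R K (p a) = algebraMap R K g * c a := by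
  obtain ⟨b, hb⟩ := IsLocalization.exist_integer_multiples_of_finite (nonZeroDivisors (R ⧸ P)) c
  choose q hq using hb
  obtain ⟨g, hg⟩ := Ideal.Quotient.mk_surjective (b : R ⧸ P)
  refine ⟨g, fun hgP => nonZeroDivisors.coe_ne_zero b ?_, fun a => (q a).out, fun a => ?_⟩
  · rw [← hg, Ideal.Quotient.eq_zero_iff_mem]
    exact hgP
  · rw [IsScalarTower.algebraMap_apply R (R ⧸ P) K, IsScalarTower.algebraMap_apply R (R ⧸ P) K g,
      Ideal.Quotient.algebraMap_eq, Ideal.Quotient.mk_out, hq, hg, Algebra.smul_def]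

theorem exists_linearIndependent_grad {κ : Type*} [Fintype κ] [Fintype σ] {T : Set (σ → ℂ)}
    (hP : P ∈ (vanishingIdeal ℂ T).minimalPrimes) (G : κ → MvPolynomial σ ℂ)
    (hG : LinearIndependent K fun k => grad (fun l => algebraMap (MvPolynomial σ ℂ) K (X l)) (G k)) :
    ∃ h ∉ P, ∀ x ∈ T, aeval x h ≠ 0 → LinearIndependent ℂ fun k => grad x (G k) := by
  classical
  have hsurj := Matrix.mulVec_surjective_of_linearIndependent_row
    (M := Matrix.of fun k => grad (fun l => algebraMap (MvPolynomial σ ℂ) K (X l)) (G k)) hG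
  choose r hr using fun k : κ => hsurj (Pi.single k 1)
  obtain ⟨g, hg, p, hp⟩ := exists_common_denominator_of_isFractionRing_quotient (K := K) P
    fun a : κ × σ => r a.1 a.2
  let q : κ × κ → MvPolynomial σ ℂ := fun a =>
    ∑ l, pderiv l (G a.1) * p (a.2, l) - if a.1 = a.2 then g else 0
  have hq : ∀ a, q a ∈ P := fun a => by
    rw [← algebraMap_eq_zero_iff_mem_of_isFractionRing_quotient (K := K)]
    have h1 := congrFun (hr a.2) a.1
    simp only [Matrix.mulVec, dotProduct, Matrix.of_apply, grad, aeval_algebraMap_X] at h1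
    simp only [q, map_sub, map_sum, map_mul, hp]
    have h2 : ∀ l, algebraMap (MvPolynomial σ ℂ) K (pderiv l (G a.1)) *
      (algebraMap (MvPolynomial σ ℂ) K g * r a.2 l) = algebraMap (MvPolynomial σ ℂ) K g *
      (algebraMap (MvPolynomial σ ℂ) K (pderiv l (G a.1)) * r a.2 l) := fun l => by ring
    simp only [h2, ← Finset.mul_sum, h1, Pi.single_apply]
    split_ifs <;> simp
  choose s hs hsq using fun a => (isRadical_vanishingIdeal T).exists_notMem_mul_mem hP (hq a)
  refine ⟨g * ∏ a, s a, fun h => ?_, fun x hx hxh => ?_⟩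
  · rcases hPp.mem_or_mem h with h | h
    · exact hg h
    · obtain ⟨a, -, ha⟩ := (hPp.prod_mem_iff).1 h
      exact hs a ha
  · rw [map_mul, map_prod] at hxh
    have hqx : ∀ a, aeval x (q a) = 0 := fun a => by
      have := hsq a x hx
      rw [map_mul] at this
      exact (mul_eq_zero.1 this).resolve_left (Finset.prod_ne_zero_iff.1 (right_ne_zero_of_mul hxh) a
        (Finset.mem_univ a))
    rw [Fintype.linearIndependent_iff]
    intro c hc k
    have h1 : ∀ k', ∑ l, grad x (G k') l * aeval x (p (k, l)) =
        if k' = k then aeval x g else 0 := fun k' => by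
      have := hqx (k', k)
      simp only [q, map_sub, map_sum, map_mul, sub_eq_zero] at this
      simp only [grad, this]
      split_ifs <;> simp
    have h2 : ∑ k', c k' * ∑ l, grad x (G k') l * aeval x (p (k, l)) = 0 := by
      simp only [Finset.mul_sum]
      rw [Finset.sum_comm]
      refine Finset.sum_eq_zero fun l _ => ?_
      have := congrFun hc l
      simp only [Finset.sum_apply, Pi.smul_apply, smul_eq_mul, Pi.zero_apply] at this
      simp only [← mul_assoc, ← Finset.sum_mul, this, zero_mul]
    simp only [h1, mul_ite, mul_zero, Finset.sum_ite_eq', Finset.mem_univ, if_true] at h2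
    exact (mul_eq_zero.1 h2).resolve_right (left_ne_zero_of_mul hxh)

theorem linearIndependent_grad_of_forall {κ : Type*} [Fintype κ] [Fintype σ] {T : Set (σ → ℂ)}
    (hP : P ∈ (vanishingIdeal ℂ T).minimalPrimes) {D : MvPolynomial σ ℂ} (hD : D ∉ P)
    {G : κ → MvPolynomial σ ℂ}
    (hG : ∀ x ∈ T, aeval x D ≠ 0 → LinearIndependent ℂ fun k => grad x (G k)) :
    LinearIndependent K fun k => grad (fun l => algebraMap (MvPolynomial σ ℂ) K (X l)) (G k) := by
  rw [Fintype.linearIndependent_iff]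
  intro c hc
  by_contra! hne
  obtain ⟨k, hk⟩ := hne
  obtain ⟨g, hg, p, hp⟩ := exists_common_denominator_of_isFractionRing_quotient P c
  have hq : ∀ l, ∑ k, p k * pderiv l (G k) ∈ P := fun l => by
    rw [← algebraMap_eq_zero_iff_mem_of_isFractionRing_quotient (K := K)]
    have := congrFun hc l
    simp only [Finset.sum_apply, Pi.smul_apply, smul_eq_mul, Pi.zero_apply, grad,
      aeval_algebraMap_X] at this
    simp only [map_sum, map_mul, hp, mul_assoc, ← Finset.mul_sum, this, mul_zero]
  have hpk : p k ∉ P := by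
    rw [← algebraMap_eq_zero_iff_mem_of_isFractionRing_quotient (K := K), hp]
    exact mul_ne_zero (mt (algebraMap_eq_zero_iff_mem_of_isFractionRing_quotient P).1 hg) hk
  choose s hs hsq using fun l => (isRadical_vanishingIdeal T).exists_notMem_mul_mem hP (hq l)
  refine hpk ?_
  have hmem : (D * ∏ l, s l) * p k ∈ vanishingIdeal ℂ T := fun x hx => by
    rw [map_mul]
    by_cases h : aeval x (D * ∏ l, s l) = 0
    · rw [h, zero_mul]
    rw [map_mul, map_prod] at h
    have h1 := Fintype.linearIndependent_iff.1 (hG x hx (left_ne_zero_of_mul h))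
      (fun k => aeval x (p k)) (by
        ext l
        have := hsq l x hx
        rw [map_mul] at this
        have := (mul_eq_zero.1 this).resolve_left (Finset.prod_ne_zero_iff.1 (right_ne_zero_of_mul h) l
          (Finset.mem_univ l))
        simpa [grad] using this) k
    rw [h1, mul_zero]
  refine (hPp.mem_or_mem (hP.1.2 hmem)).resolve_left fun h => ?_
  rcases hPp.mem_or_mem h with h | h
  · exact hD h
  · obtain ⟨a, -, ha⟩ := (hPp.prod_mem_iff).1 h
    exact hs a ha

theorem grad_mem_span_of_mem_minimalPrimes {ι : Type} [Fintype ι] [Fintype σ] {T : Set (σ → ℂ)}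
    (hP : P ∈ (vanishingIdeal ℂ T).minimalPrimes) {D : MvPolynomial σ ℂ} (hD : D ∉ P)
    {H : ι → MvPolynomial σ ℂ} (hT : ∀ y, aeval y D ≠ 0 → (y ∈ T ↔ ∀ k, aeval y (H k) = 0))
    (hH : ∀ x ∈ T, aeval x D ≠ 0 → LinearIndependent ℂ fun k => grad x (H k))
    {f : MvPolynomial σ ℂ} (hf : f ∈ P) :
    grad (fun l => algebraMap (MvPolynomial σ ℂ) K (X l)) f ∈ Submodule.span K (Set.range fun k =>
      grad (fun l => algebraMap (MvPolynomial σ ℂ) K (X l)) (H k)) := by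
  classical
  obtain ⟨s, hs, hsf⟩ := (isRadical_vanishingIdeal T).exists_notMem_mul_mem hP hf
  have hsK : algebraMap (MvPolynomial σ ℂ) K s ≠ 0 :=
    mt (algebraMap_eq_zero_iff_mem_of_isFractionRing_quotient P).1 hs
  by_contra hfH
  have hsfH : grad (fun l => algebraMap (MvPolynomial σ ℂ) K (X l)) (s * f) ∉
      Submodule.span K (Set.range fun k =>
        grad (fun l => algebraMap (MvPolynomial σ ℂ) K (X l)) (H k)) := by
    rwa [grad_mul, aeval_algebraMap_X, aeval_algebraMap_X,
      (algebraMap_eq_zero_iff_mem_of_isFractionRing_quotient P).2 hf, zero_smul, add_zero,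
      Submodule.smul_mem_iff _ hsK]
  have hopt := (linearIndependent_grad_of_forall (K := K) hP hD hH).option hsfH
  let G : Option ι → MvPolynomial σ ℂ := fun o => o.casesOn' (s * f) H
  obtain ⟨h, hh, hhT⟩ := exists_linearIndependent_grad (K := K) hP G (by
    convert! hopt using 1
    ext k : 1
    cases k <;> rfl)
  have hDh : D * h ∉ P := fun hmem => (hPp.mem_or_mem hmem).elim hD hh
  obtain ⟨x, hx, hxDh⟩ : ∃ x ∈ T, aeval x (D * h) ≠ 0 := by
    by_contra! hall
    exact hDh (hP.1.2 hall)
  rw [map_mul] at hxDh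
  have hxD := left_ne_zero_of_mul hxDh
  have hmem := grad_mem_span_of_mem_vanishingIdeal (fun y hy hyD => (hT y hyD).2 hy)
      ((hT x hxD).1 hx) hxD (hH x hx hxD) hsf
  exact (linearIndependent_option.1 (hhT x hx (right_ne_zero_of_mul hxDh))).2 hmem

theorem finrank_derivation_add_card {ι : Type} [Fintype ι] [Fintype σ] {T : Set (σ → ℂ)}
    (hP : P ∈ (vanishingIdeal ℂ T).minimalPrimes) {D : MvPolynomial σ ℂ} (hD : D ∉ P)
    {H : ι → MvPolynomial σ ℂ} (hT : ∀ y, aeval y D ≠ 0 → (y ∈ T ↔ ∀ k, aeval y (H k) = 0))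
    (hH : ∀ x ∈ T, aeval x D ≠ 0 → LinearIndependent ℂ fun k => grad x (H k))
    [IsScalarTower ℂ (MvPolynomial σ ℂ ⧸ P) K] :
    Module.finrank K (Derivation ℂ K K) + Fintype.card ι = Fintype.card σ := by
  let z : σ → K := fun l => algebraMap (MvPolynomial σ ℂ) K (X l)
  let M : Matrix ι σ K := Matrix.of fun k => grad z (H k)
  have hHP : ∀ k, H k ∈ P := fun k => by
    refine (hPp.mem_or_mem (hP.1.2 (?_ : D * H k ∈ _))).resolve_left hD
    intro x hx
    rw [map_mul]
    by_cases hxD : aeval x D = 0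
    · rw [hxD, zero_mul]
    · rw [(hT x hxD).1 hx, mul_zero]
  let φ : Derivation ℂ K K →ₗ[K] (σ → K) :=
    { toFun := fun d l => d (z l), map_add' := fun _ _ => rfl, map_smul' := fun _ _ => rfl }
  have hd : ∀ (d : Derivation ℂ K K) (f : MvPolynomial σ ℂ),
      d (algebraMap (MvPolynomial σ ℂ) K f) = grad z f ⬝ᵥ φ d := fun d f => by
    rw [← aeval_algebraMap_X (R := ℂ), derivation_aeval]
    rfl
  have : Algebra.FormallyEtale (MvPolynomial σ ℂ ⧸ P) K :=
    .of_isLocalization (nonZeroDivisors (MvPolynomial σ ℂ ⧸ P))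
  have hinj : Function.Injective φ := by
    refine (injective_iff_map_eq_zero φ).2 fun d hd0 => ?_
    refine Derivation.eq_zero_of_formallyUnramified (A := MvPolynomial σ ℂ ⧸ P) d fun a => ?_
    obtain ⟨f, rfl⟩ := Ideal.Quotient.mk_surjective a
    rw [← Ideal.Quotient.algebraMap_eq, ← IsScalarTower.algebraMap_apply, hd, hd0,
      dotProduct_zero]
  have hrange : LinearMap.range φ = LinearMap.ker M.mulVecLin := by
    ext w
    rw [LinearMap.mem_ker, Matrix.mulVecLin_apply]
    constructor
    · rintro ⟨d, rfl⟩
      ext k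
      refine (hd d (H k)).symm.trans ?_
      rw [(algebraMap_eq_zero_iff_mem_of_isFractionRing_quotient P).2 (hHP k), map_zero]
      rfl
    · intro hw
      let d₀ : Derivation ℂ (MvPolynomial σ ℂ) K := mkDerivation ℂ w
      have hd₀ : ∀ f, d₀ f = grad z f ⬝ᵥ w := fun f => by
        have := derivation_aeval d₀ X f
        rw [aeval_X_left_apply] at this
        rw [this]
        refine Finset.sum_congr rfl fun l _ => ?_
        rw [aeval_X_left_apply, mkDerivation_X, Algebra.smul_def, grad, aeval_algebraMap_X]
      have hd₀P : ∀ f ∈ P, d₀ f = 0 := fun f hf => by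
        rw [hd₀]
        have hs := grad_mem_span_of_mem_minimalPrimes (K := K) hP hD hT hH hf
        change grad z f ∈ _ at hs
        generalize grad z f = g at hs
        induction hs using Submodule.span_induction with
        | mem w hw' =>
          obtain ⟨k, rfl⟩ := hw'
          exact congrFun hw k
        | zero => exact zero_dotProduct w
        | add w w' _ _ hw hw' => rw [add_dotProduct, hw, hw', add_zero]
        | smul c w _ hw => rw [smul_dotProduct, hw, smul_zero]
      let d₁ : Derivation ℂ (MvPolynomial σ ℂ ⧸ P) K :=
        Derivation.mk' ((P.restrictScalars ℂ).liftQ d₀.toLinearMap fun f hf => hd₀P f hf) (by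
          rintro ⟨a⟩ ⟨b⟩
          change d₀ (a * b) = Ideal.Quotient.mk P a • d₀ b + Ideal.Quotient.mk P b • d₀ a
          rw [d₀.leibniz, Algebra.smul_def, Algebra.smul_def, Algebra.smul_def, Algebra.smul_def,
            IsScalarTower.algebraMap_apply _ (MvPolynomial σ ℂ ⧸ P) K,
            IsScalarTower.algebraMap_apply _ (MvPolynomial σ ℂ ⧸ P) K b]
          rfl)
      obtain ⟨d, hd'⟩ := Derivation.exists_extend_of_formallyEtale (B := K) d₁
      refine ⟨d, funext fun l => ?_⟩
      have h1 := hd' (Ideal.Quotient.mk P (X l))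
      rw [← Ideal.Quotient.algebraMap_eq, ← IsScalarTower.algebraMap_apply] at h1
      exact h1.trans (mkDerivation_X ℂ w l)
  have h1 := LinearMap.finrank_range_add_finrank_ker M.mulVecLin
  have h2 : M.rank = Fintype.card ι :=
    (linearIndependent_grad_of_forall (K := K) hP hD hH).rank_matrix
  rw [Module.finrank_fintype_fun_eq_card, ← hrange, LinearMap.finrank_range_of_inj hinj] at h1
  rw [← h1, ← h2, add_comm]
  rfl

end Dimension

theorem isPureDim_of_cover {σ γ ι : Type} [Fintype σ] [Fintype ι] [Finite γ] {T : Set (σ → ℂ)}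
    {D : γ → MvPolynomial σ ℂ} {H : γ → ι → MvPolynomial σ ℂ}
    (hcov : ∀ x ∈ T, ∃ c, aeval x (D c) ≠ 0)
    (hT : ∀ c y, aeval y (D c) ≠ 0 → (y ∈ T ↔ ∀ k, aeval y (H c k) = 0))
    (hH : ∀ c, ∀ x ∈ T, aeval x (D c) ≠ 0 → LinearIndependent ℂ fun k => grad x (H c k)) {d : ℕ}
    (hd : d + Fintype.card ι = Fintype.card σ) : IsPureDim T d := by
  intro P hP
  have hPp := hP.isPrime
  cases nonempty_fintype γ
  obtain ⟨c, hc⟩ : ∃ c, D c ∉ P := by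
    by_contra! h
    choose s hs hsD using fun c => (isRadical_vanishingIdeal T).exists_notMem_mul_mem hP (h c)
    refine (mt hPp.prod_mem_iff.1 (by simpa using hs) : ∏ c, s c ∉ P) (hP.1.2 fun x hx => ?_)
    obtain ⟨c, hc⟩ := hcov x hx
    rw [map_prod]
    refine Finset.prod_eq_zero (Finset.mem_univ c) ?_
    have := hsD c x hx
    rw [map_mul] at this
    exact (mul_eq_zero.1 this).resolve_right hc
  let K := FractionRing (MvPolynomial σ ℂ ⧸ P)
  have h := finrank_derivation_add_card (K := K) hP hc (hT c) (hH c)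
  rw [ringKrullDim_eq_finrank_derivation (k := ℂ) (K := K)]
  have : Module.finrank K (Derivation ℂ K K) = d := by omega
  rw [this]
  rfl

section GenericSmoothness

theorem MvPolynomial.linearIndependent_grad_inr {K L α β ι : Type*} [Field K] [CharZero K]
    [Field L] [Algebra K L] [Fintype α] [Fintype β] [Fintype ι] {H : ι → MvPolynomial (α ⊕ β) K}
    {z : α ⊕ β → L} (hz : AlgebraicIndependent K (z ∘ Sum.inl)) (h0 : ∀ k, aeval z (H k) = 0)
    (h : LinearIndependent L fun k => grad z (H k)) :
    LinearIndependent L fun k => grad z (H k) ∘ Sum.inr := by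
  classical
  rw [Fintype.linearIndependent_iff] at h ⊢
  intro c hc
  have h1 : ∀ l, ∑ k, c k * grad z (H k) (Sum.inr l) = 0 := fun l => by
    simpa using congrFun hc l
  have h2 : ∀ s, ∑ k, c k * grad z (H k) (Sum.inl s) = 0 := fun s => by
    obtain ⟨d, hd⟩ := hz.exists_derivation (Pi.single s 1)
    have h3 : ∀ k, grad z (H k) (Sum.inl s) =
        -∑ l, grad z (H k) (Sum.inr l) * d (z (Sum.inr l)) := fun k => by
      have h4 := derivation_aeval d z (H k)
      rw [h0, map_zero, Fintype.sum_sum_type] at h4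
      refine eq_neg_of_add_eq_zero_left (Eq.trans ?_ h4.symm)
      congr 1
      have hd' : ∀ t, d (z (Sum.inl t)) = Pi.single (M := fun _ => L) s 1 t := hd
      simp [hd', grad, Pi.single_apply]
    simp only [h3, mul_neg, Finset.sum_neg_distrib, Finset.mul_sum, ← mul_assoc]
    rw [Finset.sum_comm]
    simp only [← Finset.sum_mul, h1, zero_mul, Finset.sum_const_zero, neg_zero]
  refine h c ?_
  ext (s | l)
  · simpa using h2 s
  · simpa using h1 l

theorem Ideal.exists_field_aeval_eq_zero_iff {σ : Type} (P : Ideal (MvPolynomial σ ℂ))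
    [P.IsPrime] : ∃ (L : Type) (_ : Field L) (_ : Algebra ℂ L) (z : σ → L),
      ∀ f : MvPolynomial σ ℂ, aeval z f = 0 ↔ f ∈ P := by
  refine ⟨FractionRing (MvPolynomial σ ℂ ⧸ P), inferInstance, inferInstance,
    fun i => algebraMap (MvPolynomial σ ℂ) _ (X i), fun f => ?_⟩
  rw [← algebraMap_eq_zero_iff_mem_of_isFractionRing_quotient
    (K := FractionRing (MvPolynomial σ ℂ ⧸ P))]
  exact Eq.congr_left (aeval_algebraMap_X (R := ℂ) f)

theorem MvPolynomial.exists_linearIndependent_grad_inr {α β ι : Type} [Fintype α] [Fintype β]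
    [Fintype ι] (H : ι → MvPolynomial (α ⊕ β) ℂ) (D : MvPolynomial (α ⊕ β) ℂ)
    (hH : ∀ (L : Type) [Field L] [Algebra ℂ L] (z : α ⊕ β → L), (∀ k, aeval z (H k) = 0) →
      aeval z D ≠ 0 → LinearIndependent L fun k => grad z (H k)) :
    ∃ h : MvPolynomial α ℂ, h ≠ 0 ∧ ∀ z : α ⊕ β → ℂ, aeval (z ∘ Sum.inl) h ≠ 0 →
      (∀ k, aeval z (H k) = 0) → aeval z D ≠ 0 →
      LinearIndependent ℂ fun k => grad z (H k) ∘ Sum.inr := by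
  classical
  let R := MvPolynomial ((α ⊕ β) ⊕ (ι ⊕ ι)) ℂ
  let lam : ι → R := fun k => X (Sum.inr (Sum.inl k))
  let mu : ι → R := fun k => X (Sum.inr (Sum.inr k))
  let E₀ : ι → R := fun k => rename Sum.inl (H k)
  let E₁ : β → R := fun l => ∑ k, lam k * rename Sum.inl (pderiv (Sum.inr l) (H k))
  let E₂ : R := rename Sum.inl D * ∑ k, mu k * lam k - 1
  let J : Ideal R := Ideal.span (Set.range E₀ ∪ Set.range E₁ ∪ {E₂})
  let ρ : MvPolynomial α ℂ →ₐ[ℂ] R := rename (Sum.inl ∘ Sum.inl)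
  have hE₀ : ∀ k, E₀ k ∈ J := fun k => Ideal.subset_span (.inl (.inl ⟨k, rfl⟩))
  have hE₁ : ∀ l, E₁ l ∈ J := fun l => Ideal.subset_span (.inl (.inr ⟨l, rfl⟩))
  have hE₂ : E₂ ∈ J := Ideal.subset_span (.inr rfl)
  by_cases hdisj : Disjoint (J : Set R) ((nonZeroDivisors (MvPolynomial α ℂ)).map ρ : Submonoid R)
  · exfalso
    obtain ⟨P, hP, hJP, hPd⟩ := Ideal.exists_le_prime_disjoint J _ hdisj
    obtain ⟨L, _, _, z', hz'⟩ := P.exists_field_aeval_eq_zero_iff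
    let z : α ⊕ β → L := z' ∘ Sum.inl
    have h0 : ∀ k, aeval z (H k) = 0 := fun k => by
      have := (hz' _).2 (hJP (hE₀ k))
      rwa [aeval_rename] at this
    have h1 : ∀ l, ∑ k, z' (Sum.inr (Sum.inl k)) * grad z (H k) (Sum.inr l) = 0 := fun l => by
      have := (hz' _).2 (hJP (hE₁ l))
      rw [map_sum] at this
      refine Eq.trans (Finset.sum_congr rfl fun k _ => ?_) this
      rw [map_mul, aeval_X, aeval_rename]
      rfl
    have h2 : aeval z D * ∑ k, z' (Sum.inr (Sum.inr k)) * z' (Sum.inr (Sum.inl k)) = 1 := by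
      have := (hz' _).2 (hJP hE₂)
      simpa only [E₂, lam, mu, map_sub, map_one, map_sum, map_mul, aeval_X, aeval_rename,
        sub_eq_zero] using this
    have halg : AlgebraicIndependent ℂ (z ∘ Sum.inl) := by
      refine (injective_iff_map_eq_zero _).2 fun f hf => ?_
      by_contra hf0
      refine Set.disjoint_left.1 hPd ((hz' (ρ f)).1 ?_)
        (Submonoid.mem_map_of_mem ρ (mem_nonZeroDivisors_of_ne_zero hf0))
      rw [aeval_rename]
      exact hf
    have hli := hH L z h0 (left_ne_zero_of_mul_eq_one h2)
    have hli' : LinearIndependent L fun k => grad z (H k) ∘ Sum.inr :=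
      linearIndependent_grad_inr halg h0 hli
    have h3 := Fintype.linearIndependent_iff.1 hli' (fun k => z' (Sum.inr (Sum.inl k)))
      (by
        ext l
        rw [Finset.sum_apply]
        exact h1 l)
    simp [h3] at h2
  · obtain ⟨_, hfJ, h, hh, rfl⟩ := Set.not_disjoint_iff.1 hdisj
    refine ⟨h, nonZeroDivisors.ne_zero hh, fun z hzh hz hzD => ?_⟩
    by_contra hdep
    rw [Fintype.not_linearIndependent_iff] at hdep
    obtain ⟨c, hc, k₀, hk₀⟩ := hdep
    let z' : (α ⊕ β) ⊕ (ι ⊕ ι) → ℂ :=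
      Sum.elim z (Sum.elim c (Pi.single k₀ (aeval z D * c k₀)⁻¹))
    have hz'z : z' ∘ Sum.inl = z := rfl
    have hJ : J ≤ RingHom.ker (aeval z' : R →ₐ[ℂ] ℂ) := by
      refine Ideal.span_le.2 ?_
      rintro _ ((⟨k, rfl⟩ | ⟨l, rfl⟩) | rfl)
      · change aeval z' (rename Sum.inl (H k)) = 0
        rw [aeval_rename, hz'z, hz]
      · change aeval z' (E₁ l) = 0
        have := congrFun hc l
        simp only [Finset.sum_apply, Pi.smul_apply, smul_eq_mul, Function.comp_apply,
          Pi.zero_apply] at this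
        rw [map_sum]
        refine Eq.trans (Finset.sum_congr rfl fun k _ => ?_) this
        rw [map_mul, aeval_X, aeval_rename]
        rfl
      · change aeval z' E₂ = 0
        simp only [E₂, lam, mu, map_sub, map_one, map_sum, map_mul, aeval_X, aeval_rename, hz'z,
          sub_eq_zero]
        simp only [z', Sum.elim_inr, Sum.elim_inl, Pi.single_apply, ite_mul, zero_mul,
          Finset.sum_ite_eq', Finset.mem_univ, if_true]
        rw [mul_inv, ← mul_assoc, ← mul_assoc, mul_inv_cancel₀ hzD, one_mul, inv_mul_cancel₀ hk₀]
    have := hJ hfJ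
    refine hzh ?_
    change aeval z' (rename _ h) = 0 at this
    rwa [aeval_rename] at this

end GenericSmoothness

section SchurComplement

open Matrix

variable {κ μ ν ρ υ ψ : Type*} [Fintype κ] [Fintype ρ]

/-- The square block of a matrix singled out by a choice of some of the lower rows and of
complementary sets of columns. -/
def Matrix.leadBlock {S : Type*} (N : Matrix (κ ⊕ μ) ν S) (e : ρ ⊕ υ ≃ μ)
    (τ : (κ ⊕ ρ) ⊕ ψ ≃ ν) : Matrix (κ ⊕ ρ) (κ ⊕ ρ) S :=
  N.submatrix (Sum.map id (e ∘ Sum.inl)) (τ ∘ Sum.inl)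

/-- The Schur complement of the block `Matrix.leadBlock`, multiplied by the determinant of this
block. -/
def Matrix.schurMinors {S : Type*} [CommRing S] [DecidableEq κ] [DecidableEq ρ]
    (N : Matrix (κ ⊕ μ) ν S) (e : ρ ⊕ υ ≃ μ)
    (τ : (κ ⊕ ρ) ⊕ ψ ≃ ν) : Matrix υ ψ S :=
  (N.leadBlock e τ).det • N.submatrix (Sum.inr ∘ e ∘ Sum.inr) (τ ∘ Sum.inr) -
    N.submatrix (Sum.inr ∘ e ∘ Sum.inr) (τ ∘ Sum.inl) * (N.leadBlock e τ).adjugate *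
      N.submatrix (Sum.map id (e ∘ Sum.inl)) (τ ∘ Sum.inr)

theorem RingHom.map_det_leadBlock {S S' : Type*} [CommRing S] [CommRing S'] [DecidableEq κ]
    [DecidableEq ρ] (φ : S →+* S')
    (N : Matrix (κ ⊕ μ) ν S) (e : ρ ⊕ υ ≃ μ) (τ : (κ ⊕ ρ) ⊕ ψ ≃ ν) :
    φ (N.leadBlock e τ).det = ((N.map φ).leadBlock e τ).det := by
  rw [RingHom.map_det]
  rfl

theorem RingHom.map_schurMinors {S S' : Type*} [CommRing S] [CommRing S'] [DecidableEq κ]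
    [DecidableEq ρ] (φ : S →+* S')
    (N : Matrix (κ ⊕ μ) ν S) (e : ρ ⊕ υ ≃ μ) (τ : (κ ⊕ ρ) ⊕ ψ ≃ ν) :
    (N.schurMinors e τ).map φ = (N.map φ).schurMinors e τ := by
  have h := φ.map_adjugate (N.leadBlock e τ)
  simp only [RingHom.mapMatrix_apply] at h
  rw [schurMinors, Matrix.map_sub _ (map_sub φ), Matrix.map_mul, Matrix.map_mul, h, schurMinors,
    ← RingHom.map_det_leadBlock]
  congr 1
  ext
  simp

theorem Matrix.mulVec_eq_zero_iff_blocks {S : Type*} [CommRing S] [Fintype ψ] [Fintype ν]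
    (N : Matrix (κ ⊕ μ) ν S) (e : ρ ⊕ υ ≃ μ) (τ : (κ ⊕ ρ) ⊕ ψ ≃ ν) (v : ν → S) :
    N *ᵥ v = 0 ↔
      N.leadBlock e τ *ᵥ (v ∘ τ ∘ Sum.inl) +
        N.submatrix (Sum.map id (e ∘ Sum.inl)) (τ ∘ Sum.inr) *ᵥ (v ∘ τ ∘ Sum.inr) = 0 ∧
      N.submatrix (Sum.inr ∘ e ∘ Sum.inr) (τ ∘ Sum.inl) *ᵥ (v ∘ τ ∘ Sum.inl) +
        N.submatrix (Sum.inr ∘ e ∘ Sum.inr) (τ ∘ Sum.inr) *ᵥ (v ∘ τ ∘ Sum.inr) = 0 := by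
  have h : ∀ i, (N *ᵥ v) i = ∑ a, N i (τ (Sum.inl a)) * v (τ (Sum.inl a)) +
      ∑ b, N i (τ (Sum.inr b)) * v (τ (Sum.inr b)) := fun i => by
    rw [← Fintype.sum_sum_type fun c => N i (τ c) * v (τ c)]
    exact (τ.sum_comp fun c => N i c * v c).symm
  simp only [funext_iff, h, Pi.zero_apply, Sum.forall, ← e.forall_congr_right]
  simp [mulVec, dotProduct, leadBlock, and_assoc]

theorem Matrix.finrank_ker_eq_card_iff {K : Type*} [Field K] [Fintype υ] [Fintype ψ]
    [Fintype ν] [DecidableEq κ] [DecidableEq ρ]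
    {N : Matrix (κ ⊕ μ) ν K} {e : ρ ⊕ υ ≃ μ} {τ : (κ ⊕ ρ) ⊕ ψ ≃ ν}
    (hdet : (N.leadBlock e τ).det ≠ 0) :
    Module.finrank K (LinearMap.ker N.mulVecLin) = Fintype.card ψ ↔ N.schurMinors e τ = 0 := by
  classical
  set A := N.leadBlock e τ with hA
  set B := N.submatrix (Sum.map id (e ∘ Sum.inl)) (τ ∘ Sum.inr) with hB
  set C := N.submatrix (Sum.inr ∘ e ∘ Sum.inr) (τ ∘ Sum.inl) with hC
  set E := N.submatrix (Sum.inr ∘ e ∘ Sum.inr) (τ ∘ Sum.inr) with hE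
  have hS : N.schurMinors e τ = A.det • E - C * A.adjugate * B := rfl
  have hN : ∀ v, N *ᵥ v = 0 ↔ A *ᵥ (v ∘ τ ∘ Sum.inl) + B *ᵥ (v ∘ τ ∘ Sum.inr) = 0 ∧
      C *ᵥ (v ∘ τ ∘ Sum.inl) + E *ᵥ (v ∘ τ ∘ Sum.inr) = 0 :=
    mulVec_eq_zero_iff_blocks N e τ
  let π : (ν → K) →ₗ[K] (ψ → K) := LinearMap.funLeft K K (τ ∘ Sum.inr)
  let P := π.domRestrict (LinearMap.ker N.mulVecLin)
  have hP : Function.Injective P := by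
    refine (injective_iff_map_eq_zero P).2 ?_
    rintro ⟨v, hv⟩ hv0
    refine Subtype.ext ?_
    have hv1 : v ∘ τ ∘ Sum.inr = 0 := hv0
    have h1 := ((hN v).1 hv).1
    rw [hv1, mulVec_zero, add_zero] at h1
    have h2 := eq_zero_of_mulVec_eq_zero hdet h1
    ext c
    obtain ⟨c | c, rfl⟩ := τ.surjective c
    · exact congrFun h2 c
    · exact congrFun hv1 c
  have hrange : LinearMap.range P = LinearMap.ker (N.schurMinors e τ).mulVecLin := by
    ext w
    rw [LinearMap.mem_ker, mulVecLin_apply, hS, sub_mulVec, smul_mulVec, sub_eq_zero]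
    constructor
    · rintro ⟨⟨v, hv⟩, rfl⟩
      change A.det • E *ᵥ (v ∘ τ ∘ Sum.inr) = (C * A.adjugate * B) *ᵥ (v ∘ τ ∘ Sum.inr)
      obtain ⟨h1, h2⟩ := (hN v).1 hv
      rw [eq_neg_of_add_eq_zero_right h2, ← mulVec_mulVec, eq_neg_of_add_eq_zero_right h1,
        mulVec_neg, mulVec_mulVec, Matrix.mul_assoc, adjugate_mul, Matrix.mul_smul,
        Matrix.mul_one, smul_mulVec,
        smul_neg]
    · intro hw
      let v₁ : κ ⊕ ρ → K := -(A.det⁻¹ • A.adjugate *ᵥ B *ᵥ w)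
      have hinl : (Sum.elim v₁ w ∘ τ.symm) ∘ τ ∘ Sum.inl = v₁ := by
        ext c
        simp
      have hinr : (Sum.elim v₁ w ∘ τ.symm) ∘ τ ∘ Sum.inr = w := by
        ext c
        simp
      refine ⟨⟨Sum.elim v₁ w ∘ τ.symm, (hN _).2 ?_⟩, hinr⟩
      rw [hinl, hinr]
      constructor
      · rw [mulVec_neg, mulVec_smul, mulVec_mulVec, mul_adjugate, smul_mulVec, one_mulVec,
          smul_smul, inv_mul_cancel₀ hdet, one_smul, neg_add_cancel]
      · rw [mulVec_neg, mulVec_smul, mulVec_mulVec, mulVec_mulVec, ← hw, smul_smul,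
          inv_mul_cancel₀ hdet, one_smul, neg_add_cancel]
  rw [← LinearMap.finrank_range_of_inj hP, hrange]
  have hcard : Fintype.card ψ = Module.finrank K (ψ → K) :=
    (Module.finrank_fintype_fun_eq_card K).symm
  rw [hcard]
  constructor
  · intro h
    have := Submodule.eq_top_of_finrank_eq h
    rw [LinearMap.ker_eq_top, ← Matrix.mulVecLin_zero] at this
    exact Matrix.mulVec_injective (funext fun v => LinearMap.congr_fun this v)
  · intro h
    rw [h, mulVecLin_zero, LinearMap.ker_zero, finrank_top]

theorem exists_injective_linearIndependent_map {K V : Type*} [Field K] [AddCommGroup V]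
    [Module K V] [FiniteDimensional K V] [Finite μ] {v : κ ⊕ μ → V}
    (hv : LinearIndependent K (v ∘ Sum.inl))
    (hr : Module.finrank K (Submodule.span K (Set.range v)) = Fintype.card κ + Fintype.card ρ) :
    ∃ g : ρ → μ, Function.Injective g ∧ LinearIndependent K (v ∘ Sum.map id g) := by
  classical
  have hs : LinearIndepOn K v (Set.range (Sum.inl : κ → κ ⊕ μ)) :=
    (linearIndepOn_range_iff Sum.inl_injective v).2 hv
  obtain ⟨b, hb, hsb, hvb, hbi⟩ := exists_linearIndepOn_extension hs (Set.subset_univ _)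
  have hspan : Submodule.span K (v '' b) = Submodule.span K (Set.range v) := by
    refine le_antisymm (Submodule.span_mono (Set.image_subset_range v b)) (Submodule.span_le.2 ?_)
    rwa [Set.image_univ] at hvb
  let g : κ ⊕ Sum.inr ⁻¹' b → κ ⊕ μ := Sum.map id Subtype.val
  have hg : Function.Injective g := Function.injective_id.sumMap Subtype.val_injective
  have hgb : Set.range g = b := by
    ext (c | c)
    · exact iff_of_true ⟨Sum.inl c, rfl⟩ (hsb ⟨c, rfl⟩)
    · constructor
      · rintro ⟨c' | c', hc'⟩
        · cases hc'
        · rw [← hc']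
          exact c'.2
      · exact fun hc => ⟨Sum.inr ⟨c, hc⟩, rfl⟩
  have hgi : LinearIndependent K (v ∘ g) :=
    (linearIndepOn_range_iff hg v).1 (by rwa [hgb])
  have := Fintype.ofFinite (Sum.inr ⁻¹' b : Set μ)
  have hcard := finrank_span_eq_card hgi
  rw [Set.range_comp, hgb, hspan, hr, Fintype.card_sum, add_right_inj] at hcard
  let f := Fintype.equivOfCardEq hcard
  refine ⟨Subtype.val ∘ f, Subtype.val_injective.comp f.injective, ?_⟩
  convert! hgi.comp (Sum.map id f) (Function.injective_id.sumMap f.injective) using 1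
  ext (c | c) <;> rfl

theorem Function.Injective.exists_sum_equiv {α β γ : Type*} [Fintype α] [Fintype β] [Fintype γ]
    {g : α → γ} (hg : g.Injective) (h : Fintype.card α + Fintype.card β = Fintype.card γ) :
    ∃ e : α ⊕ β ≃ γ, e ∘ Sum.inl = g := by
  classical
  have h1 : Fintype.card β = Fintype.card ↑(Set.range g)ᶜ := by
    have := Fintype.card_congr (Equiv.Set.sumCompl (Set.range g))
    rw [Fintype.card_sum, Set.card_range_of_injective hg] at this
    omega
  exact ⟨(Equiv.sumCongr (Equiv.ofInjective g hg) (Fintype.equivOfCardEq h1)).trans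
    (Equiv.Set.sumCompl (Set.range g)), rfl⟩

theorem Matrix.exists_det_leadBlock_ne_zero {K : Type*} [Field K] [Fintype υ] [Fintype ψ]
    [Fintype ν] [Fintype μ] [DecidableEq κ] [DecidableEq ρ] {N : Matrix (κ ⊕ μ) ν K}
    (hN : LinearIndependent K (N.row ∘ Sum.inl))
    (hker : Module.finrank K (LinearMap.ker N.mulVecLin) = Fintype.card ψ)
    (hμ : Fintype.card ρ + Fintype.card υ = Fintype.card μ)
    (hν : Fintype.card κ + Fintype.card ρ + Fintype.card ψ = Fintype.card ν) :
    ∃ (e : ρ ⊕ υ ≃ μ) (τ : (κ ⊕ ρ) ⊕ ψ ≃ ν), (N.leadBlock e τ).det ≠ 0 := by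
  classical
  have hrank : N.rank = Fintype.card κ + Fintype.card ρ := by
    have := LinearMap.finrank_range_add_finrank_ker N.mulVecLin
    rw [hker, Module.finrank_fintype_fun_eq_card, ← hν] at this
    exact add_right_cancel this
  obtain ⟨g, hg, hgi⟩ := exists_injective_linearIndependent_map (ρ := ρ) hN
    (by rw [← rank_eq_finrank_span_row, hrank])
  obtain ⟨e, he⟩ := hg.exists_sum_equiv hμ
  let M : Matrix (κ ⊕ ρ) ν K := N.submatrix (Sum.map id g) id
  have hMr : M.rank = Fintype.card (κ ⊕ ρ) := LinearIndependent.rank_matrix hgi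
  obtain ⟨g', hg', hgi'⟩ := exists_injective_linearIndependent_map (κ := Empty) (ρ := κ ⊕ ρ)
    (v := Sum.elim Empty.elim M.col) (K := K) linearIndependent_empty_type (by
      rw [Set.Sum.elim_range, Set.range_eq_empty, Set.empty_union, ← rank_eq_finrank_span_cols, hMr]
      simp)
  obtain ⟨τ, hτ⟩ := hg'.exists_sum_equiv (β := ψ) (by rw [← hν, Fintype.card_sum])
  refine ⟨e, τ, ?_⟩
  have h : (N.leadBlock e τ) = M.submatrix id g' := by
    rw [leadBlock, he, hτ]
    rfl
  rw [h, ← isUnit_iff_ne_zero, ← isUnit_iff_isUnit_det, ← linearIndependent_cols_iff_isUnit]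
  exact hgi'.comp Sum.inr Sum.inr_injective

end SchurComplement

section UniversalMatrix

open Matrix

variable {κ μ ν ρ υ ψ : Type}

/-- The Jacobian matrix of `f`, extended by a matrix of indeterminates. -/
noncomputable def MvPolynomial.extendedJacobian (μ : Type) (f : κ → MvPolynomial ν ℂ) :
    Matrix (κ ⊕ μ) ν (MvPolynomial ((μ × ν) ⊕ ν) ℂ) :=
  fromRows (Matrix.of fun k l => rename Sum.inr (pderiv l (f k)))
    (Matrix.of fun s t => X (Sum.inl (s, t)))

theorem MvPolynomial.extendedJacobian_map {L : Type*} [CommRing L] [Algebra ℂ L]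
    (f : κ → MvPolynomial ν ℂ) (z : (μ × ν) ⊕ ν → L) :
    (extendedJacobian μ f).map (aeval z : MvPolynomial ((μ × ν) ⊕ ν) ℂ →ₐ[ℂ] L) =
      fromRows (Matrix.of fun k => grad (z ∘ Sum.inr) (f k))
        (Matrix.of fun s t => z (Sum.inl (s, t))) := by
  ext (k | s) l
  · simp [extendedJacobian, aeval_rename, grad]
  · simp [extendedJacobian]

theorem MvPolynomial.pderiv_inl_rename_inr {R α β : Type*} [CommRing R] (i : α)
    (f : MvPolynomial β R) :
    pderiv (Sum.inl i) (rename Sum.inr f : MvPolynomial (α ⊕ β) R) = 0 := by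
  classical
  refine pderiv_eq_zero_of_notMem_vars fun h => ?_
  obtain ⟨j, -, hj⟩ := mem_vars_rename _ _ h
  cases hj

variable [Fintype κ] [Fintype ρ] [DecidableEq κ] [DecidableEq ρ]

/-- The equations of the locus where the kernel of the matrix `extendedJacobian μ f` has the
dimension prescribed by the size of a nonsingular block. -/
noncomputable def MvPolynomial.stratumEquations (f : κ → MvPolynomial ν ℂ) (e : ρ ⊕ υ ≃ μ)
    (τ : (κ ⊕ ρ) ⊕ ψ ≃ ν) : κ ⊕ υ × ψ → MvPolynomial ((μ × ν) ⊕ ν) ℂ :=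
  Sum.elim (fun k => rename Sum.inr (f k))
    fun q => (extendedJacobian μ f).schurMinors e τ q.1 q.2

theorem Derivation.apply_schurMinors {S A : Type*} [CommRing S] [CommRing A] [Algebra S A]
    (d : Derivation S A A) {N : Matrix (κ ⊕ μ) ν A} {e : ρ ⊕ υ ≃ μ} {τ : (κ ⊕ ρ) ⊕ ψ ≃ ν}
    (h₁ : ∀ k l, d (N (Sum.map id (e ∘ Sum.inl) k) l) = 0)
    (h₂ : ∀ k l, d (N (Sum.inr (e (Sum.inr k))) (τ (Sum.inl l))) = 0) (s : υ) (t : ψ) :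
    d (N.schurMinors e τ s t) =
      (N.leadBlock e τ).det * d (N (Sum.inr (e (Sum.inr s))) (τ (Sum.inr t))) := by
  let A₀ : Subalgebra S A :=
    { carrier := {x | d x = 0}
      mul_mem' := fun {a b} (ha : d a = 0) (hb : d b = 0) =>
        show d (a * b) = 0 by rw [d.leibniz, ha, hb, smul_zero, smul_zero, add_zero]
      add_mem' := fun {a b} (ha : d a = 0) (hb : d b = 0) =>
        show d (a + b) = 0 by rw [map_add, ha, hb, add_zero]
      algebraMap_mem' := fun r => d.map_algebraMap r }
  let A' : Matrix (κ ⊕ ρ) (κ ⊕ ρ) A₀ := Matrix.of fun k l => ⟨N.leadBlock e τ k l, h₁ k _⟩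
  let B' : Matrix (κ ⊕ ρ) ψ A₀ :=
    Matrix.of fun k l => ⟨N (Sum.map id (e ∘ Sum.inl) k) (τ (Sum.inr l)), h₁ k _⟩
  let C' : Matrix υ (κ ⊕ ρ) A₀ :=
    Matrix.of fun k l => ⟨N (Sum.inr (e (Sum.inr k))) (τ (Sum.inl l)), h₂ _ _⟩
  let φ : A₀ →+* A := A₀.val
  have hA' : N.leadBlock e τ = A'.map φ := rfl
  have hB' : N.submatrix (Sum.map id (e ∘ Sum.inl)) (τ ∘ Sum.inr) = B'.map φ := rfl
  have hC' : N.submatrix (Sum.inr ∘ e ∘ Sum.inr) (τ ∘ Sum.inl) = C'.map φ := rfl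
  have hφ : ∀ x, d (φ x) = 0 := fun x => x.2
  have hdet : (A'.map φ).det = φ A'.det := (φ.map_det A').symm
  have hadj : (A'.map φ).adjugate = A'.adjugate.map φ := (φ.map_adjugate A').symm
  rw [schurMinors, hB', hC', hA', hdet, hadj, ← Matrix.map_mul, ← Matrix.map_mul,
    Matrix.sub_apply, map_apply, Matrix.smul_apply, map_sub, hφ, sub_zero, smul_eq_mul, d.leibniz,
    hφ, smul_zero, add_zero]
  rfl

theorem MvPolynomial.pderiv_schurMinors (f : κ → MvPolynomial ν ℂ)
    (e : ρ ⊕ υ ≃ μ) (τ : (κ ⊕ ρ) ⊕ ψ ≃ ν) (s s' : υ) (t t' : ψ) :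
    pderiv (Sum.inl (e (Sum.inr s), τ (Sum.inr t)))
      ((extendedJacobian μ f).schurMinors e τ s' t') =
      ((extendedJacobian μ f).leadBlock e τ).det * pderiv (Sum.inl (e (Sum.inr s), τ (Sum.inr t)))
        (X (Sum.inl (e (Sum.inr s'), τ (Sum.inr t')))) := by
  refine Derivation.apply_schurMinors _ (fun k l => ?_) (fun k l => ?_) s' t'
  · rcases k with k | k
    · exact pderiv_inl_rename_inr _ _
    · exact pderiv_X_of_ne (by simp)
  · exact pderiv_X_of_ne (by simp)

theorem MvPolynomial.linearIndependent_grad_stratumEquations [Fintype μ] [Fintype ν] [Fintype υ]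
    [Fintype ψ] {L : Type*}
    [Field L] [Algebra ℂ L] (f : κ → MvPolynomial ν ℂ) (e : ρ ⊕ υ ≃ μ) (τ : (κ ⊕ ρ) ⊕ ψ ≃ ν)
    {z : (μ × ν) ⊕ ν → L} (hz : aeval z ((extendedJacobian μ f).leadBlock e τ).det ≠ 0) :
    LinearIndependent L fun k => grad z (stratumEquations f e τ k) := by
  classical
  rw [Fintype.linearIndependent_iff]
  intro c hc
  have hinr : ∀ q, c (Sum.inr q) = 0 := fun ⟨s, t⟩ => by
    have h := congrFun hc (Sum.inl (e (Sum.inr s), τ (Sum.inr t)))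
    have h0 : ∀ k, grad z (rename Sum.inr (f k)) (Sum.inl (e (Sum.inr s), τ (Sum.inr t))) = 0 :=
      fun k => by rw [grad, pderiv_inl_rename_inr, map_zero]
    have h1 : ∀ q : υ × ψ, grad z ((extendedJacobian μ f).schurMinors e τ q.1 q.2)
        (Sum.inl (e (Sum.inr s), τ (Sum.inr t))) = if q = (s, t) then
          aeval z ((extendedJacobian μ f).leadBlock e τ).det else 0 := fun q => by
      rw [grad, pderiv_schurMinors, pderiv_X]
      simp [Pi.single_apply, Prod.ext_iff, eq_comm, apply_ite (aeval z)]
    simpa [Fintype.sum_sum_type, stratumEquations, h0, h1, hz] using h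
  have hvec : Sum.elim (c ∘ Sum.inl) 0 ᵥ* (((extendedJacobian μ f).leadBlock e τ).map
      (aeval z : MvPolynomial ((μ × ν) ⊕ ν) ℂ →ₐ[ℂ] L)) = 0 := by
    ext l
    have h := congrFun hc (Sum.inr (τ (Sum.inl l)))
    simpa [vecMul, dotProduct, Fintype.sum_sum_type, stratumEquations, hinr, leadBlock,
      extendedJacobian, grad, pderiv_rename Sum.inr_injective] using h
  have h0 := eq_zero_of_vecMul_eq_zero (by rwa [AlgHom.map_det] at hz) hvec
  rintro (k | q)
  · exact congrFun h0 (Sum.inl k)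
  · exact hinr q

end UniversalMatrix

section Stratum

open Matrix

/-- Specialization of some of the variables of a polynomial. -/
noncomputable def MvPolynomial.specialize {R α β : Type*} [CommRing R] (a : α → R) :
    MvPolynomial (α ⊕ β) R →ₐ[R] MvPolynomial β R :=
  aeval (Sum.elim (fun s => C (a s)) X)

theorem MvPolynomial.aeval_specialize {R α β : Type*} [CommRing R] (a : α → R) (x : β → R)
    (f : MvPolynomial (α ⊕ β) R) : aeval x (specialize a f) = aeval (Sum.elim a x) f := by
  rw [specialize, ← AlgHom.comp_apply, comp_aeval]
  congr 2
  ext (s | s) <;> simp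

theorem MvPolynomial.grad_specialize {R α β : Type*} [CommRing R] [Fintype α] [Fintype β]
    (a : α → R) (x : β → R) (f : MvPolynomial (α ⊕ β) R) :
    grad x (specialize a f) = grad (Sum.elim a x) f ∘ Sum.inr := by
  classical
  ext l
  rw [grad, specialize, derivation_aeval, Fintype.sum_sum_type,
    Finset.sum_eq_zero fun s _ => ?_, zero_add, Finset.sum_eq_single l]
  · rw [Sum.elim_inr, pderiv_X_self, smul_eq_mul, mul_one]
    exact aeval_specialize a x _
  · intro s _ hs
    rw [Sum.elim_inr, pderiv_X_of_ne hs, smul_zero]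
  · simp
  · rw [Sum.elim_inl, pderiv_C, smul_zero]

variable {κ μ ν ρ υ ψ : Type} [Fintype κ] [Fintype μ] [Fintype ν] [Fintype ρ] [Fintype υ]
  [Fintype ψ] [DecidableEq ν]

theorem exists_generic_stratum (f : κ → MvPolynomial ν ℂ)
    (hf : ∀ x : ν → ℂ, (∀ k, aeval x (f k) = 0) → LinearIndependent ℂ fun k => grad x (f k))
    (hμ : Fintype.card ρ + Fintype.card υ = Fintype.card μ)
    (hν : Fintype.card κ + Fintype.card ρ + Fintype.card ψ = Fintype.card ν) :
    ∃ h : MvPolynomial (μ × ν) ℂ, h ≠ 0 ∧ ∀ a : Matrix μ ν ℂ, aeval (fun q => a q.1 q.2) h ≠ 0 →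
      ∀ T : Set (ν → ℂ), (∀ x, x ∈ T ↔ (∀ k, aeval x (f k) = 0) ∧
        Module.finrank ℂ (LinearMap.ker
          (fromRows (Matrix.of fun k => grad x (f k)) a).mulVecLin) = Fintype.card ψ) →
      (∀ x ∈ T, Module.finrank ℂ (tangentAt T x) +
        (Fintype.card κ + Fintype.card υ * Fintype.card ψ) = Fintype.card ν) ∧
      ∀ d, d + (Fintype.card κ + Fintype.card υ * Fintype.card ψ) = Fintype.card ν →
        IsPureDim T d := by
  classical
  let D : (ρ ⊕ υ ≃ μ) × ((κ ⊕ ρ) ⊕ ψ ≃ ν) → MvPolynomial ((μ × ν) ⊕ ν) ℂ :=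
    fun c => ((extendedJacobian μ f).leadBlock c.1 c.2).det
  let H : (ρ ⊕ υ ≃ μ) × ((κ ⊕ ρ) ⊕ ψ ≃ ν) → κ ⊕ υ × ψ → MvPolynomial ((μ × ν) ⊕ ν) ℂ :=
    fun c => stratumEquations f c.1 c.2
  choose h hh0 hh using fun c => exists_linearIndependent_grad_inr (H c) (D c)
    fun L _ _ z _ hz => linearIndependent_grad_stratumEquations f c.1 c.2 hz
  refine ⟨∏ c, h c, Finset.prod_ne_zero_iff.2 fun c _ => hh0 c, fun a ha T hT => ?_⟩
  rw [map_prod, Finset.prod_ne_zero_iff] at ha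
  let a' : μ × ν → ℂ := fun q => a q.1 q.2
  let N : (ν → ℂ) → Matrix (κ ⊕ μ) ν ℂ := fun x => fromRows (Matrix.of fun k => grad x (f k)) a
  have hN : ∀ x, (extendedJacobian μ f).map
      (aeval (Sum.elim a' x) : MvPolynomial ((μ × ν) ⊕ ν) ℂ →ₐ[ℂ] ℂ) = N x := fun x =>
    extendedJacobian_map f _
  have hD : ∀ c x, aeval x (specialize a' (D c)) = ((N x).leadBlock c.1 c.2).det := fun c x => by
    rw [aeval_specialize, ← hN]
    exact RingHom.map_det_leadBlock
      (aeval (Sum.elim a' x) : MvPolynomial ((μ × ν) ⊕ ν) ℂ →ₐ[ℂ] ℂ).toRingHom _ _ _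
  have hH : ∀ c x, (∀ k, aeval x (specialize a' (H c k)) = 0) ↔
      (∀ k, aeval x (f k) = 0) ∧ (N x).schurMinors c.1 c.2 = 0 := fun c x => by
    have h1 : ((extendedJacobian μ f).schurMinors c.1 c.2).map
        (aeval (Sum.elim a' x) : MvPolynomial ((μ × ν) ⊕ ν) ℂ →ₐ[ℂ] ℂ) =
        (N x).schurMinors c.1 c.2 := by
      rw [← hN]
      exact RingHom.map_schurMinors
        (aeval (Sum.elim a' x) : MvPolynomial ((μ × ν) ⊕ ν) ℂ →ₐ[ℂ] ℂ).toRingHom _ _ _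
    rw [← h1, ← Matrix.ext_iff]
    simp only [aeval_specialize, Sum.forall, Prod.forall, H, stratumEquations, Sum.elim_inl,
      Sum.elim_inr, aeval_rename, Sum.elim_comp_inr]
    rfl
  have hTH : ∀ c y, aeval y (specialize a' (D c)) ≠ 0 →
      (y ∈ T ↔ ∀ k, aeval y (specialize a' (H c k)) = 0) := fun c y hy => by
    rw [hD] at hy
    rw [hH, hT, finrank_ker_eq_card_iff hy]
  have hli : ∀ c, ∀ x ∈ T, aeval x (specialize a' (D c)) ≠ 0 →
      LinearIndependent ℂ fun k => grad x (specialize a' (H c k)) := fun c x hx hxD => by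
    have hxH := (hTH c x hxD).1 hx
    simp only [aeval_specialize] at hxD hxH
    simp only [grad_specialize]
    exact hh c _ (ha c (Finset.mem_univ c)) hxH hxD
  have hcov : ∀ x ∈ T, ∃ c, aeval x (specialize a' (D c)) ≠ 0 := fun x hx => by
    obtain ⟨hx1, hx2⟩ := (hT x).1 hx
    obtain ⟨e, τ, hdet⟩ := exists_det_leadBlock_ne_zero (N := N x) (hf x hx1) hx2 hμ hν
    exact ⟨(e, τ), by rwa [hD]⟩
  have hcard : Fintype.card (κ ⊕ υ × ψ) =
      Fintype.card κ + Fintype.card υ * Fintype.card ψ := by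
    rw [Fintype.card_sum, Fintype.card_prod]
  constructor
  · intro x hx
    obtain ⟨c, hc⟩ := hcov x hx
    rw [← hcard]
    exact finrank_tangentAt (hTH c) hx hc (hli c x hx hc)
  · intro d hd
    rw [← hcard] at hd
    exact isPureDim_of_cover hcov hTH hli hd

end Stratum

section GenericProjection

open Matrix

theorem Matrix.linearIndependent_row_of_rank_eq_card {κ ν K : Type*} [Fintype κ] [Fintype ν]
    [Field K] {A : Matrix κ ν K} (h : A.rank = Fintype.card κ) : LinearIndependent K A.row := by
  rw [linearIndependent_iff_card_eq_finrank_span, ← h, rank_eq_finrank_span_row]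
  rfl

theorem Matrix.rank_eq_of_det_submatrix_ne_zero {m n : ℕ} {A : Matrix (Fin m) (Fin n) ℂ}
    {g : Fin m → Fin n} (h : (A.submatrix id g).det ≠ 0) : A.rank = m := by
  refine le_antisymm (by simpa using A.rank_le_height) ?_
  have h1 := rank_of_det_ne_zero h
  rw [Fintype.card_fin] at h1
  exact h1.symm.le.trans (rank_submatrix_le _ _ _)

theorem MvPolynomial.exists_aeval_matrix_ne_zero {m n : ℕ} {P : MvPolynomial (Fin m × Fin n) ℂ}
    (hP : P ≠ 0) : ∃ a : Matrix (Fin m) (Fin n) ℂ, aeval (fun q => a q.1 q.2) P ≠ 0 := by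
  by_contra! h
  exact hP (funext fun x => by simpa [coe_aeval_eq_eval] using h (Matrix.of fun s t => x (s, t)))

theorem zOpenMat_setOf_aeval_ne_zero {m n : ℕ} (P : MvPolynomial (Fin m × Fin n) ℂ) :
    ZOpenMat {a : Matrix (Fin m) (Fin n) ℂ | aeval (fun q => a q.1 q.2) P ≠ 0} := by
  refine ⟨Ideal.span {P}, Set.ext fun a => ?_⟩
  simp only [Set.mem_ofPred_eq]
  constructor
  · exact fun h => ⟨P, Ideal.mem_span_singleton_self P, h⟩
  · rintro ⟨f, hf, hfa⟩ h
    obtain ⟨g, rfl⟩ := Ideal.mem_span_singleton.1 hf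
    exact hfa (by rw [map_mul]; exact mul_eq_zero_of_left h _)

/-- A maximal minor of the generic matrix. -/
noncomputable def genericMinor {m n : ℕ} (h : m ≤ n) : MvPolynomial (Fin m × Fin n) ℂ :=
  (Matrix.of fun s t : Fin m => X (s, Fin.castLE h t)).det

theorem aeval_genericMinor {m n : ℕ} (h : m ≤ n) (a : Matrix (Fin m) (Fin n) ℂ) :
    aeval (fun q => a q.1 q.2) (genericMinor h) = (a.submatrix id (Fin.castLE h)).det := by
  rw [genericMinor, AlgHom.map_det]
  congr 1
  ext s t
  simp

theorem genericMinor_ne_zero {m n : ℕ} (h : m ≤ n) : genericMinor h ≠ 0 := by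
  intro h0
  have h1 := aeval_genericMinor h (Matrix.of fun s l => if l = Fin.castLE h s then 1 else 0)
  rw [h0, map_zero] at h1
  have h2 : (Matrix.of fun (s : Fin m) (l : Fin n) =>
      if l = Fin.castLE h s then (1 : ℂ) else 0).submatrix id (Fin.castLE h) = 1 := by
    ext s t
    simp [Matrix.one_apply, eq_comm]
  rw [h2, det_one] at h1
  exact zero_ne_one h1

variable {n p : ℕ} (F : Fin p → MvPolynomial (Fin n) ℚ)

theorem jacC_eq_of_grad (x : Fin n → ℂ) :
    jacC F x = Matrix.of fun k => grad x (MvPolynomial.map (algebraMap ℚ ℂ) (F k)) := by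
  ext k l
  simp [jacC, grad, pderiv_map, aeval_map_algebraMap]

theorem mem_zeroSetC_iff (x : Fin n → ℂ) :
    x ∈ zeroSetC F ↔ ∀ k, aeval x (MvPolynomial.map (algebraMap ℚ ℂ) (F k)) = 0 := by
  simp [zeroSetC, aeval_map_algebraMap]

variable {F}

theorem linearIndependent_grad_of_smooth (hsmooth : SregC F = zeroSetC F) (x : Fin n → ℂ)
    (hx : ∀ k, aeval x (MvPolynomial.map (algebraMap ℚ ℂ) (F k)) = 0) :
    LinearIndependent ℂ fun k => grad x (MvPolynomial.map (algebraMap ℚ ℂ) (F k)) := by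
  rw [← mem_zeroSetC_iff, ← hsmooth] at hx
  have h := hx.2
  rw [jacC_eq_of_grad] at h
  exact linearIndependent_row_of_rank_eq_card (h.trans (Fintype.card_fin p).symm)

theorem mem_SigmaStr_iff (hsmooth : SregC F = zeroSetC F) {m : ℕ} (a : Matrix (Fin m) (Fin n) ℂ)
    (j : ℕ) (x : Fin n → ℂ) :
    x ∈ SigmaStr F a j ↔ (∀ k, aeval x (MvPolynomial.map (algebraMap ℚ ℂ) (F k)) = 0) ∧
      Module.finrank ℂ (LinearMap.ker (fromRows (Matrix.of fun k =>
        grad x (MvPolynomial.map (algebraMap ℚ ℂ) (F k))) a).mulVecLin) = j := by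
  rw [SigmaStr, Set.mem_ofPred_eq, hsmooth, mem_zeroSetC_iff]
  refine and_congr_right fun hx => ?_
  have h1 : tangentAt (zeroSetC F) x = LinearMap.ker (Matrix.of fun k =>
      grad x (MvPolynomial.map (algebraMap ℚ ℂ) (F k))).mulVecLin :=
    tangentAt_eq_ker (D := 1) (fun y _ => mem_zeroSetC_iff F y) ((mem_zeroSetC_iff F x).2 hx)
      (by simp) (linearIndependent_grad_of_smooth hsmooth x hx)
  rw [h1]
  suffices h2 : ∀ A : Matrix (Fin p) (Fin n) ℂ, LinearMap.ker A.mulVecLin ⊓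
      LinearMap.ker a.mulVecLin = LinearMap.ker (fromRows A a).mulVecLin by rw [h2]
  intro A
  ext v
  simp [fromRows_mulVec, Sum.elim_eq_iff, ← Sum.elim_zero_zero]

theorem exists_generic_SigmaStr (hsmooth : SregC F = zeroSetC F) {m r u j : ℕ}
    (hm : r + u = m) (hn : p + r + j = n) :
    ∃ h : MvPolynomial (Fin m × Fin n) ℂ, h ≠ 0 ∧
      ∀ a : Matrix (Fin m) (Fin n) ℂ, aeval (fun q => a q.1 q.2) h ≠ 0 →
        (∀ x ∈ SigmaStr F a j,
          Module.finrank ℂ (tangentAt (SigmaStr F a j) x) + (p + u * j) = n) ∧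
        ∀ d, d + (p + u * j) = n → IsPureDim (SigmaStr F a j) d := by
  obtain ⟨h, h0, hh⟩ := exists_generic_stratum (ρ := Fin r) (υ := Fin u) (ψ := Fin j)
    (μ := Fin m) (fun k => MvPolynomial.map (algebraMap ℚ ℂ) (F k))
    (linearIndependent_grad_of_smooth hsmooth) (by simpa using hm) (by simpa using hn)
  refine ⟨h, h0, fun a ha => ?_⟩
  have h1 := hh a ha (SigmaStr F a j) fun x => by
    rw [mem_SigmaStr_iff hsmooth, Fintype.card_fin]
  simpa only [Fintype.card_fin] using h1

end GenericProjection

/-- Lemma 4 of the paper, after Mather. Suppose `S` is smooth and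
`1 ≤ i ≤ n-p`; for `j ≥ i` set `v_i(j) := (j-i+1)·j`. Then there is a nonempty Zariski
open set `U_i` of full-rank `(n-p-i+1) × n` matrices such that for every `a ∈ U_i` and
every `i ≤ j ≤ n-p` the constructible set `Σ^{(j)}(π_a)` is empty or a smooth
subvariety of `S` of codimension `v_i(j)` (i.e. of pure dimension `n-p-v_i(j)`, smooth
at each of its points). -/
theorem statement13 {n p i : ℕ} (hp1 : 1 ≤ p) (hpn : p ≤ n)
    (hi1 : 1 ≤ i) (hi2 : i ≤ n - p)
    (F : Fin p → MvPolynomial (Fin n) ℚ)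
    (hreg : IsRegSeq (List.ofFn F))
    (hrad : idealOfDef F)
    (hSne : (zeroSetC F).Nonempty)
    (hSdim : IsPureDim (zeroSetC F) (n - p))
    (hsmooth : SregC F = zeroSetC F) :
    ∃ U : Set (Matrix (Fin (n - p - i + 1)) (Fin n) ℂ),
      U.Nonempty ∧ ZOpenMat U ∧
      ∀ a ∈ U,
        a.rank = n - p - i + 1 ∧
        ∀ j, i ≤ j → j ≤ n - p →
          (SigmaStr F a j = ∅ ∨
            (SigmaStr F a j ⊆ zeroSetC F ∧
             IsPureDim (SigmaStr F a j) (n - p - (j - i + 1) * j) ∧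
             ∀ x ∈ SigmaStr F a j,
               Module.finrank ℂ ↥(tangentAt (SigmaStr F a j) x) =
                 n - p - (j - i + 1) * j)) := by
  have hmn : n - p - i + 1 ≤ n := by omega
  have key : ∀ j, ∃ h : MvPolynomial (Fin (n - p - i + 1) × Fin n) ℂ, h ≠ 0 ∧
      (i ≤ j → j ≤ n - p → ∀ a : Matrix (Fin (n - p - i + 1)) (Fin n) ℂ,
        aeval (fun q => a q.1 q.2) h ≠ 0 →
        (∀ x ∈ SigmaStr F a j,
          Module.finrank ℂ (tangentAt (SigmaStr F a j) x) + (p + (j - i + 1) * j) = n) ∧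
        ∀ d, d + (p + (j - i + 1) * j) = n → IsPureDim (SigmaStr F a j) d) := by
    intro j
    by_cases hj : i ≤ j ∧ j ≤ n - p
    · obtain ⟨h, h0, hh⟩ := exists_generic_SigmaStr hsmooth (m := n - p - i + 1)
        (r := n - p - j) (u := j - i + 1) (j := j) (by omega) (by omega)
      exact ⟨h, h0, fun _ _ => hh⟩
    · exact ⟨1, one_ne_zero, fun h1 h2 => absurd ⟨h1, h2⟩ hj⟩
  choose h h0 hh using key
  refine ⟨{a | aeval (fun q => a q.1 q.2)
      ((∏ j ∈ Finset.range (n - p + 1), h j) * genericMinor hmn) ≠ 0},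
    exists_aeval_matrix_ne_zero (mul_ne_zero (Finset.prod_ne_zero_iff.2 fun j _ => h0 j)
      (genericMinor_ne_zero hmn)), zOpenMat_setOf_aeval_ne_zero _, fun a ha => ?_⟩
  rw [Set.mem_ofPred_eq, map_mul, map_prod, mul_ne_zero_iff, Finset.prod_ne_zero_iff,
    aeval_genericMinor] at ha
  refine ⟨Matrix.rank_eq_of_det_submatrix_ne_zero ha.2, fun j hij hj => ?_⟩
  obtain ⟨hfin, hdim⟩ := hh j hij hj a (ha.1 j (Finset.mem_range.2 (by omega)))
  obtain he | ⟨x, hx⟩ := (SigmaStr F a j).eq_empty_or_nonempty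
  · exact Or.inl he
  · have hxdim := hfin x hx
    exact Or.inr ⟨fun y hy => hy.1.1, hdim _ (by omega), fun y hy => by
      have := hfin y hy
      omega⟩
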